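/- Let Z(t), t ∈ [0,T], be a Gaussian process satisfying the hypotheses of the Leadbetter–Cryer theorem: almost surely continuously differentiable sample paths, m(s) = E[Z(s)] continuously differentiable, covariance Γ(s,t) with mixed second derivatives continuous at the diagonal, σ(s)² = Γ(s,s) > 0, and μ(s) = Corr[Z(s),Z'(s)] ≠ ±1 for all s. Define M(t) = m(t)/σ(t), and assume M is continuously differentiable with finitely many zeros, all in (0,T) and all simple (M' ≠ 0 there), and that M' has finitely many zeros. Let N_z^0 be the number of zeros of M in [0,T]; let |M| have local maximum values M_1,…,M_{L_mx} with weights ν̂_j (1 at endpoints, 2 interior) and nonzero local minimum values m_1,…,m_{L_mn} with weights ν_j (1 at endpoints, 2 interior), counting M(0) and M(T) as relative extrema. Then E[N_z] − N_z^0 = Σ_{j=1}^{L_mn} ν_j Φ(−m_j) − Σ_{j=1}^{L_mx} ν̂_j Φ(−M_j) + ∫_0^T (ξ(s)γ(s)/σ(s)) φ(m(s)/σ(s)) Q̃(η(s)) ds, where N_z is the number of zeros of Z in [0,T], ξ(s)² = Var[Z'(s)], γ(s)² = 1 − μ(s)², η(s) = [m'(s) − ξ(s)μ(s)m(s)/σ(s)]/(ξ(s)γ(s)),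 φ(z) = (2π)^{−1/2}e^{−z²/2}, Φ(z) = ∫_{−∞}^z φ(u)du, and Q̃(z) = 2∫_{|z|}^∞ φ(s')(s' − |z|)ds'. -/

import Mathlib

open MeasureTheory ProbabilityTheory intervalIntegral

/-- The standard Gaussian density. -/
noncomputable def phi (z : ℝ) : ℝ := (Real.sqrt (2 * Real.pi))⁻¹ * Real.exp (-(z ^ 2) / 2)

/-- The standard Gaussian distribution function. -/
noncomputable def Phi (z : ℝ) : ℝ := ∫ u in Set.Iic z, phi u

/-- The remainder function `Q̃(z) = 2∫_{|z|}^∞ φ(s')(s' − |z|) ds'`. -/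
noncomputable def Qt (z : ℝ) : ℝ := 2 * ∫ s in Set.Ioi |z|, phi s * (s - |z|)

open Filter Topology Set

lemma phi_eq_gaussianPDFReal (z : ℝ) : phi z = gaussianPDFReal 0 1 z := by
  simp [phi, gaussianPDFReal]

lemma continuous_phi : Continuous phi := by
  unfold phi; fun_prop

lemma phi_pos (z : ℝ) : 0 < phi z := by
  unfold phi; positivity

lemma phi_le_one (z : ℝ) : phi z ≤ 1 := by
  unfold phi
  have h1 : (√(2 * Real.pi))⁻¹ ≤ 1 := by
    apply inv_le_one_of_one_le₀
    rw [Real.one_le_sqrt]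
    nlinarith [Real.pi_gt_three]
  have h2 : Real.exp (-(z ^ 2) / 2) ≤ 1 := by
    rw [Real.exp_le_one_iff]
    nlinarith [sq_nonneg z]
  exact mul_le_one₀ h1 (Real.exp_pos _).le h2

lemma phi_neg (z : ℝ) : phi (-z) = phi z := by simp [phi]

lemma phi_abs (z : ℝ) : phi |z| = phi z := by simp [phi]

lemma integrable_phi : Integrable phi := by
  rw [show phi = gaussianPDFReal 0 1 from funext phi_eq_gaussianPDFReal]
  exact integrable_gaussianPDFReal 0 1

lemma integral_phi : ∫ z, phi z = 1 := by
  rw [show phi = gaussianPDFReal 0 1 from funext phi_eq_gaussianPDFReal]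
  exact integral_gaussianPDFReal_eq_one 0 one_ne_zero

lemma Phi_sub (a b : ℝ) : Phi b - Phi a = ∫ u in a..b, phi u :=
  integral_Iic_sub_Iic integrable_phi.integrableOn integrable_phi.integrableOn

lemma hasStrictDerivAt_Phi (z : ℝ) : HasStrictDerivAt Phi (phi z) z := by
  have h : Phi = fun b => (∫ u in (0 : ℝ)..b, phi u) + Phi 0 := by
    ext b
    rw [← Phi_sub]
    ring
  rw [h]
  exact (integral_hasStrictDerivAt_right (continuous_phi.intervalIntegrable _ _)
    (continuous_phi.stronglyMeasurableAtFilter _ _) continuous_phi.continuousAt).add_const _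

lemma continuous_Phi : Continuous Phi :=
  continuous_iff_continuousAt.2 fun z => (hasStrictDerivAt_Phi z).hasDerivAt.continuousAt

lemma monotone_Phi : Monotone Phi :=
  monotone_of_hasDerivAt_nonneg (fun z => (hasStrictDerivAt_Phi z).hasDerivAt)
    (fun z => (phi_pos z).le)

lemma abs_Phi_sub_le (a b : ℝ) : |Phi b - Phi a| ≤ |b - a| := by
  rw [Phi_sub]
  have := norm_integral_le_of_norm_le_const (a := a) (b := b) (f := phi) (C := 1)
    (fun x _ => by rw [Real.norm_eq_abs, abs_of_pos (phi_pos x)]; exact phi_le_one x)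
  simpa using this

lemma Phi_zero : Phi 0 = 1 / 2 := by
  have h1 : ∫ u in Iic (0 : ℝ), phi u = ∫ u in Ioi (0 : ℝ), phi u := by
    have := integral_comp_neg_Iic (0 : ℝ) phi
    simpa [phi_neg] using this
  have h2 := intervalIntegral.integral_Iic_add_Ioi (b := (0 : ℝ)) (f := phi) (μ := volume)
    integrable_phi.integrableOn integrable_phi.integrableOn
  rw [integral_phi, ← h1] at h2
  unfold Phi
  linarith

lemma integral_gaussianReal_eq (f : ℝ → ℝ) :
    ∫ x, f x ∂(gaussianReal 0 1) = ∫ x, phi x * f x := by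
  rw [integral_gaussianReal_eq_integral_smul one_ne_zero]
  simp [phi_eq_gaussianPDFReal]

lemma integrable_id_gaussianReal : Integrable (fun x : ℝ => x) (gaussianReal 0 1) := by
  have := (memLp_id_gaussianReal (μ := 0) (v := 1) 1).integrable (by simp)
  exact this

lemma gaussianReal_uIoo (a b : ℝ) :
    gaussianReal 0 1 (Ioo (min a b) (max a b)) = ENNReal.ofReal |Phi b - Phi a| := by
  rw [gaussianReal_apply_eq_integral 0 one_ne_zero]
  congr 1
  simp_rw [← phi_eq_gaussianPDFReal]
  rw [← integral_Ioc_eq_integral_Ioo, ← integral_of_le min_le_max, ← Phi_sub]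
  rcases le_total a b with h | h
  · rw [min_eq_left h, max_eq_right h, abs_of_nonneg (sub_nonneg.2 (monotone_Phi h))]
  · rw [min_eq_right h, max_eq_left h, abs_sub_comm,
      abs_of_nonneg (sub_nonneg.2 (monotone_Phi h))]

lemma integral_abs_add_gaussianReal_of_nonneg {z : ℝ} (hz : 0 ≤ z) :
    ∫ x, |z + x| ∂(gaussianReal 0 1) = z + Qt z := by
  have hi : Integrable (fun x : ℝ => x) (gaussianReal 0 1) := integrable_id_gaussianReal
  have hneg : ∫ x, |z + x| ∂(gaussianReal 0 1) = ∫ x, |z - x| ∂(gaussianReal 0 1) := by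
    conv_lhs => rw [← neg_zero, ← gaussianReal_map_neg (μ := 0) (v := 1)]
    rw [integral_map (by fun_prop) (by fun_prop)]
    simp [sub_eq_add_neg]
  have hdec : ∀ x, |z - x| = (z - x) + 2 * (Ioi z).indicator (fun x => x - z) x := by
    intro x
    by_cases h : z < x
    · rw [indicator_of_mem (mem_Ioi.2 h), abs_of_nonpos (by linarith)]; ring
    · rw [indicator_of_notMem (by simpa using h), abs_of_nonneg (by linarith)]; ring
  have hi1 : Integrable (fun x : ℝ => z - x) (gaussianReal 0 1) := (integrable_const z).sub hi
  have hi2 : Integrable ((Ioi z).indicator (fun x => x - z)) (gaussianReal 0 1) :=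
    (hi.sub (integrable_const z)).indicator measurableSet_Ioi
  rw [hneg]
  simp_rw [hdec]
  rw [integral_add hi1 (hi2.const_mul 2), MeasureTheory.integral_const_mul,
    integral_sub (integrable_const z) hi, integral_gaussianReal_eq (indicator _ _)]
  have : (∫ x, x ∂(gaussianReal 0 1)) = 0 := integral_id_gaussianReal
  rw [this]
  unfold Qt
  rw [abs_of_nonneg hz, ← MeasureTheory.integral_indicator measurableSet_Ioi]
  simp only [MeasureTheory.integral_const, probReal_univ, smul_eq_mul, one_mul, sub_zero]
  congr 3
  ext x
  by_cases h : x ∈ Ioi z <;> simp [h, indicator]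

lemma Qt_neg (z : ℝ) : Qt (-z) = Qt z := by simp [Qt]

lemma integral_abs_add_gaussianReal (z : ℝ) :
    ∫ x, |z + x| ∂(gaussianReal 0 1) = |z| + Qt z := by
  rcases le_total 0 z with hz | hz
  · rw [integral_abs_add_gaussianReal_of_nonneg hz, abs_of_nonneg hz]
  · rw [abs_of_nonpos hz, ← Qt_neg z, ← integral_abs_add_gaussianReal_of_nonneg (neg_nonneg.2 hz)]
    conv_lhs => rw [← neg_zero, ← gaussianReal_map_neg (μ := 0) (v := 1)]
    rw [integral_map (by fun_prop) (by fun_prop)]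
    congr 1
    ext x
    rw [← abs_neg]
    ring_nf

/-- The mean absolute value of a Gaussian variable with mean `a` and standard deviation `l`. -/
lemma integral_abs_add_mul_gaussianReal (a : ℝ) {l : ℝ} (hl : 0 ≤ l) :
    ∫ x, |a + l * x| ∂(gaussianReal 0 1) = |a| + l * Qt (a / l) := by
  rcases hl.eq_or_lt with rfl | hl
  · simp
  · have : ∀ x, |a + l * x| = l * |a / l + x| := by
      intro x
      rw [← abs_of_pos hl, ← abs_mul, abs_of_pos hl]
      congr 1
      field_simp
    simp_rw [this]
    rw [MeasureTheory.integral_const_mul, integral_abs_add_gaussianReal, mul_add, abs_div,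
      abs_of_pos hl]
    field_simp

lemma forall_pos_or_forall_neg_of_ne_zero {f : ℝ → ℝ} {a b : ℝ} (hf : ContinuousOn f (Ioo a b))
    (h0 : ∀ t ∈ Ioo a b, f t ≠ 0) :
    (∀ t ∈ Ioo a b, 0 < f t) ∨ (∀ t ∈ Ioo a b, f t < 0) := by
  by_contra! h
  obtain ⟨⟨s, hs, hs'⟩, t, ht, ht'⟩ := h
  obtain ⟨u, hu, hu'⟩ := isPreconnected_Ioo.intermediate_value hs ht hf ⟨hs', ht'⟩
  exact h0 u hu hu'

section Variation

variable {T : ℝ} {M M' : ℝ → ℝ}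

lemma hasDerivAt_of_mem_Ioo (hM : ∀ t ∈ Icc (0 : ℝ) T, HasDerivWithinAt M (M' t) (Icc 0 T) t)
    {t : ℝ} (ht : t ∈ Ioo 0 T) : HasDerivAt M (M' t) t :=
  (hM t (Ioo_subset_Icc_self ht)).hasDerivAt (Icc_mem_nhds ht.1 ht.2)

lemma continuousOn_of_hasDerivWithinAt
    (hM : ∀ t ∈ Icc (0 : ℝ) T, HasDerivWithinAt M (M' t) (Icc 0 T) t) :
    ContinuousOn M (Icc 0 T) := fun t ht => (hM t ht).continuousWithinAt

/-- On an interval where `M` and `M'` do not vanish, `Φ(-|M|)` is an antiderivative of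
`±φ(M)|M'|`. -/
lemma integral_phi_mul_abs_of_sign (hM : ∀ t ∈ Icc (0 : ℝ) T, HasDerivWithinAt M (M' t) (Icc 0 T) t)
    (hM' : ContinuousOn M' (Icc 0 T)) {a b : ℝ} (ha : 0 ≤ a) (hab : a < b) (hb : b ≤ T)
    {e : ℝ} (he : ∀ t ∈ Ioo a b, M t ≠ 0 ∧ |M' t| = e * (SignType.sign (M t) * M' t)) :
    ∫ t in a..b, phi (M t) * |M' t| = e * Phi (-|M a|) - e * Phi (-|M b|) := by
  have hsub : Icc a b ⊆ Icc 0 T := Icc_subset_Icc ha hb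
  have hMc : ContinuousOn M (Icc a b) := (continuousOn_of_hasDerivWithinAt hM).mono hsub
  have hM'c : ContinuousOn M' (Icc a b) := hM'.mono hsub
  have key := integral_eq_sub_of_hasDerivAt_of_le (a := a) (b := b)
    (f := fun t => -(e * Phi (-|M t|))) (f' := fun t => phi (M t) * |M' t|) hab.le
    ((continuousOn_const.mul (continuous_Phi.comp_continuousOn hMc.abs.neg)).neg)
    (fun t ht => by
      have hd := hasDerivAt_of_mem_Ioo hM ⟨ha.trans_lt ht.1, ht.2.trans_le hb⟩
      have h1 := (((hasStrictDerivAt_Phi (-|M t|)).hasDerivAt.comp t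
        ((hasDerivAt_abs (he t ht).1).comp t hd).neg).const_mul e).neg
      refine h1.congr_deriv ?_
      rw [(he t ht).2, phi_neg, phi_abs]
      ring)
    (by
      apply ContinuousOn.intervalIntegrable
      rw [uIcc_of_le hab.le]
      exact (continuous_phi.comp_continuousOn hMc).mul hM'c.abs)
  rw [key]
  ring

lemma integral_phi_mul_abs_of_pos (hM : ∀ t ∈ Icc (0 : ℝ) T, HasDerivWithinAt M (M' t) (Icc 0 T) t)
    (hM' : ContinuousOn M' (Icc 0 T)) {a b : ℝ} (ha : 0 ≤ a) (hab : a < b) (hb : b ≤ T)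
    (hpos : ∀ t ∈ Ioo a b, 0 < M t * M' t) :
    ∫ t in a..b, phi (M t) * |M' t| = Phi (-|M a|) - Phi (-|M b|) := by
  have := integral_phi_mul_abs_of_sign hM hM' ha hab hb (e := 1) (fun t ht => by
    have h := hpos t ht
    refine ⟨left_ne_zero_of_mul h.ne', ?_⟩
    rcases pos_and_pos_or_neg_and_neg_of_mul_pos h with ⟨h1, h2⟩ | ⟨h1, h2⟩
    · simp [h1, abs_of_pos h2]
    · simp [h1, abs_of_neg h2])
  simpa using this

lemma integral_phi_mul_abs_of_neg (hM : ∀ t ∈ Icc (0 : ℝ) T, HasDerivWithinAt M (M' t) (Icc 0 T) t)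
    (hM' : ContinuousOn M' (Icc 0 T)) {a b : ℝ} (ha : 0 ≤ a) (hab : a < b) (hb : b ≤ T)
    (hneg : ∀ t ∈ Ioo a b, M t * M' t < 0) :
    ∫ t in a..b, phi (M t) * |M' t| = -Phi (-|M a|) + Phi (-|M b|) := by
  have := integral_phi_mul_abs_of_sign hM hM' ha hab hb (e := -1) (fun t ht => by
    have h := hneg t ht
    refine ⟨left_ne_zero_of_mul h.ne, ?_⟩
    rcases mul_neg_iff.1 h with ⟨h1, h2⟩ | ⟨h1, h2⟩
    · simp [h1, abs_of_neg h2]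
    · simp [h1, abs_of_pos h2])
  simpa using this

lemma abs_lt_abs_of_pos (hM : ∀ t ∈ Icc (0 : ℝ) T, HasDerivWithinAt M (M' t) (Icc 0 T) t)
    {a b : ℝ} (ha : 0 ≤ a) (hb : b ≤ T) (hpos : ∀ t ∈ Ioo a b, 0 < M t * M' t)
    {s t : ℝ} (hs : s ∈ Icc a b) (ht : t ∈ Icc a b) (hst : s < t) : |M s| < |M t| := by
  have hmono : StrictMonoOn (fun t => M t ^ 2) (Icc a b) := by
    apply strictMonoOn_of_deriv_pos (convex_Icc a b)
    · exact ((continuousOn_of_hasDerivWithinAt hM).mono (Icc_subset_Icc ha hb)).pow 2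
    · intro t ht
      rw [interior_Icc] at ht
      have hd := hasDerivAt_of_mem_Ioo hM ⟨ha.trans_lt ht.1, ht.2.trans_le hb⟩
      have := (hd.fun_pow 2).deriv
      rw [this]
      have := hpos t ht
      norm_num
      nlinarith
  exact sq_lt_sq.1 (hmono hs ht hst)

lemma abs_lt_abs_of_neg (hM : ∀ t ∈ Icc (0 : ℝ) T, HasDerivWithinAt M (M' t) (Icc 0 T) t)
    {a b : ℝ} (ha : 0 ≤ a) (hb : b ≤ T) (hneg : ∀ t ∈ Ioo a b, M t * M' t < 0)
    {s t : ℝ} (hs : s ∈ Icc a b) (ht : t ∈ Icc a b) (hst : s < t) : |M t| < |M s| := by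
  have hanti : StrictAntiOn (fun t => M t ^ 2) (Icc a b) := by
    apply strictAntiOn_of_deriv_neg (convex_Icc a b)
    · exact ((continuousOn_of_hasDerivWithinAt hM).mono (Icc_subset_Icc ha hb)).pow 2
    · intro t ht
      rw [interior_Icc] at ht
      have hd := hasDerivAt_of_mem_Ioo hM ⟨ha.trans_lt ht.1, ht.2.trans_le hb⟩
      have := (hd.fun_pow 2).deriv
      rw [this]
      have := hneg t ht
      norm_num
      nlinarith
  exact sq_lt_sq.1 (hanti hs ht hst)

open Classical in
/-- The sign of `f` immediately to the right of `x`. -/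
noncomputable def rightSign (f : ℝ → ℝ) (x : ℝ) : ℝ := if ∀ᶠ t in 𝓝[>] x, 0 < f t then 1 else -1

open Classical in
/-- The sign of `f` immediately to the left of `x`. -/
noncomputable def leftSign (f : ℝ → ℝ) (x : ℝ) : ℝ := if ∀ᶠ t in 𝓝[<] x, 0 < f t then 1 else -1

lemma rightSign_of_pos {f : ℝ → ℝ} {a b : ℝ} (hab : a < b) (h : ∀ t ∈ Ioo a b, 0 < f t) :
    rightSign f a = 1 :=
  if_pos (by filter_upwards [Ioo_mem_nhdsGT hab] using h)

lemma leftSign_of_pos {f : ℝ → ℝ} {a b : ℝ} (hab : a < b) (h : ∀ t ∈ Ioo a b, 0 < f t) :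
    leftSign f b = 1 :=
  if_pos (by filter_upwards [Ioo_mem_nhdsLT hab] using h)

lemma rightSign_of_neg {f : ℝ → ℝ} {a b : ℝ} (hab : a < b) (h : ∀ t ∈ Ioo a b, f t < 0) :
    rightSign f a = -1 :=
  if_neg fun h' => by
    obtain ⟨t, ht, ht'⟩ := (h'.and (Ioo_mem_nhdsGT hab)).exists
    exact lt_asymm ht (h t ht')

lemma leftSign_of_neg {f : ℝ → ℝ} {a b : ℝ} (hab : a < b) (h : ∀ t ∈ Ioo a b, f t < 0) :
    leftSign f b = -1 :=
  if_neg fun h' => by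
    obtain ⟨t, ht, ht'⟩ := (h'.and (Ioo_mem_nhdsLT hab)).exists
    exact lt_asymm ht (h t ht')

lemma integral_phi_mul_abs_eq_sum
    (hM : ∀ t ∈ Icc (0 : ℝ) T, HasDerivWithinAt M (M' t) (Icc 0 T) t)
    (hM' : ContinuousOn M' (Icc 0 T)) (S : Finset ℝ)
    (hS : ∀ t ∈ Ioo 0 T, M t * M' t = 0 → t ∈ S) (n : ℕ) :
    ∀ a b : ℝ, 0 ≤ a → a < b → b ≤ T → (S.filter (fun x => a < x ∧ x < b)).card = n →
    ∫ t in a..b, phi (M t) * |M' t| =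
      rightSign (fun t => M t * M' t) a * Phi (-|M a|)
        - leftSign (fun t => M t * M' t) b * Phi (-|M b|)
        + ∑ x ∈ S.filter (fun x => a < x ∧ x < b),
          (rightSign (fun t => M t * M' t) x - leftSign (fun t => M t * M' t) x)
            * Phi (-|M x|) := by
  induction n using Nat.strong_induction_on with
  | _ n ih =>
    intro a b ha hab hb hn
    have hsub : Ioo a b ⊆ Icc 0 T := Ioo_subset_Icc_self.trans (Icc_subset_Icc ha hb)
    by_cases hne : (S.filter (fun x => a < x ∧ x < b)).Nonempty
    · obtain ⟨c, hc⟩ := hne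
      have hc' := Finset.mem_filter.1 hc
      obtain ⟨hcS, hac, hcb⟩ := hc'
      have hunion : S.filter (fun x => a < x ∧ x < b) =
          insert c (S.filter (fun x => a < x ∧ x < c) ∪ S.filter (fun x => c < x ∧ x < b)) := by
        ext x
        simp only [Finset.mem_filter, Finset.mem_insert, Finset.mem_union]
        constructor
        · rintro ⟨h1, h2, h3⟩
          rcases lt_trichotomy x c with h | h | h
          · exact Or.inr (Or.inl ⟨h1, h2, h⟩)
          · exact Or.inl h
          · exact Or.inr (Or.inr ⟨h1, h, h3⟩)
        · rintro (rfl | ⟨h1, h2, h3⟩ | ⟨h1, h2, h3⟩)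
          · exact ⟨hcS, hac, hcb⟩
          · exact ⟨h1, h2, h3.trans hcb⟩
          · exact ⟨h1, hac.trans h2, h3⟩
      have hdisj : Disjoint (S.filter (fun x => a < x ∧ x < c))
          (S.filter (fun x => c < x ∧ x < b)) := by
        rw [Finset.disjoint_left]
        intro x hx hx'
        simp only [Finset.mem_filter] at hx hx'
        linarith [hx.2.2, hx'.2.1]
      have hcn : c ∉ S.filter (fun x => a < x ∧ x < c) ∪ S.filter (fun x => c < x ∧ x < b) := by
        simp
      have hcard := congrArg Finset.card hunion
      rw [Finset.card_insert_of_notMem hcn, Finset.card_union_of_disjoint hdisj, hn] at hcard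
      have hInt : ∀ u v : ℝ, a ≤ u → u ≤ v → v ≤ b →
          IntervalIntegrable (fun t => phi (M t) * |M' t|) volume u v := by
        intro u v hu huv hv
        apply ContinuousOn.intervalIntegrable
        rw [uIcc_of_le huv]
        have hs : Icc u v ⊆ Icc 0 T := Icc_subset_Icc (ha.trans hu) (hv.trans hb)
        exact (continuous_phi.comp_continuousOn
          ((continuousOn_of_hasDerivWithinAt hM).mono hs)).mul (hM'.mono hs).abs
      rw [← integral_add_adjacent_intervals (hInt a c le_rfl hac.le hcb.le)
        (hInt c b hac.le hcb.le le_rfl),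
        ih _ (by omega) a c ha hac (hcb.le.trans hb) rfl,
        ih _ (by omega) c b (ha.trans hac.le) hcb hb rfl, hunion, Finset.sum_insert hcn,
        Finset.sum_union hdisj]
      ring
    · rw [Finset.not_nonempty_iff_eq_empty] at hne
      rw [hne, Finset.sum_empty, add_zero]
      have h0 : ∀ t ∈ Ioo a b, M t * M' t ≠ 0 := by
        intro t ht h
        have := hS t ⟨ha.trans_lt ht.1, ht.2.trans_le hb⟩ h
        have : t ∈ S.filter (fun x => a < x ∧ x < b) := Finset.mem_filter.2 ⟨this, ht⟩
        simp [hne] at this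
      rcases forall_pos_or_forall_neg_of_ne_zero (f := fun t => M t * M' t)
        (((continuousOn_of_hasDerivWithinAt hM).mul hM').mono hsub) h0 with h | h
      · rw [integral_phi_mul_abs_of_pos hM hM' ha hab hb h, rightSign_of_pos hab h,
          leftSign_of_pos hab h]
        ring
      · rw [integral_phi_mul_abs_of_neg hM hM' ha hab hb h, rightSign_of_neg hab h,
          leftSign_of_neg hab h]
        ring

lemma right_dichotomy (hM : ∀ t ∈ Icc (0 : ℝ) T, HasDerivWithinAt M (M' t) (Icc 0 T) t)
    (hM' : ContinuousOn M' (Icc 0 T)) (S : Finset ℝ)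
    (hS : ∀ t ∈ Ioo 0 T, M t * M' t = 0 → t ∈ S) {x : ℝ} (hx : 0 ≤ x) (hxT : x < T) :
    (rightSign (fun t => M t * M' t) x = 1 ∧ ∀ᶠ t in 𝓝[>] x, |M x| < |M t|) ∨
    (rightSign (fun t => M t * M' t) x = -1 ∧ ∀ᶠ t in 𝓝[>] x, |M t| < |M x|) := by
  have hcl : ((S : Set ℝ) \ {x})ᶜ ∈ 𝓝[>] x :=
    mem_nhdsWithin_of_mem_nhds
      ((S.finite_toSet.subset sdiff_subset).isClosed.isOpen_compl.mem_nhds (by simp))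
  obtain ⟨c, hc, hsub⟩ := (mem_nhdsGT_iff_exists_mem_Ioc_Ioo_subset hxT).1 hcl
  have h0 : ∀ t ∈ Ioo x c, M t * M' t ≠ 0 := fun t ht h =>
    hsub ht ⟨hS t ⟨hx.trans_lt ht.1, ht.2.trans_le hc.2⟩ h, ht.1.ne'⟩
  have hs : Ioo x c ⊆ Icc 0 T := Ioo_subset_Icc_self.trans (Icc_subset_Icc hx hc.2)
  rcases forall_pos_or_forall_neg_of_ne_zero (f := fun t => M t * M' t)
    (((continuousOn_of_hasDerivWithinAt hM).mul hM').mono hs) h0 with h | h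
  · refine Or.inl ⟨rightSign_of_pos hc.1 h, ?_⟩
    filter_upwards [Ioo_mem_nhdsGT hc.1] with t ht
    exact abs_lt_abs_of_pos hM hx hc.2 h (left_mem_Icc.2 hc.1.le) (Ioo_subset_Icc_self ht) ht.1
  · refine Or.inr ⟨rightSign_of_neg hc.1 h, ?_⟩
    filter_upwards [Ioo_mem_nhdsGT hc.1] with t ht
    exact abs_lt_abs_of_neg hM hx hc.2 h (left_mem_Icc.2 hc.1.le) (Ioo_subset_Icc_self ht) ht.1

lemma left_dichotomy (hM : ∀ t ∈ Icc (0 : ℝ) T, HasDerivWithinAt M (M' t) (Icc 0 T) t)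
    (hM' : ContinuousOn M' (Icc 0 T)) (S : Finset ℝ)
    (hS : ∀ t ∈ Ioo 0 T, M t * M' t = 0 → t ∈ S) {x : ℝ} (hx : 0 < x) (hxT : x ≤ T) :
    (leftSign (fun t => M t * M' t) x = 1 ∧ ∀ᶠ t in 𝓝[<] x, |M t| < |M x|) ∨
    (leftSign (fun t => M t * M' t) x = -1 ∧ ∀ᶠ t in 𝓝[<] x, |M x| < |M t|) := by
  have hcl : ((S : Set ℝ) \ {x})ᶜ ∈ 𝓝[<] x :=
    mem_nhdsWithin_of_mem_nhds
      ((S.finite_toSet.subset sdiff_subset).isClosed.isOpen_compl.mem_nhds (by simp))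
  obtain ⟨c, hc, hsub⟩ := (mem_nhdsLT_iff_exists_mem_Ico_Ioo_subset hx).1 hcl
  have h0 : ∀ t ∈ Ioo c x, M t * M' t ≠ 0 := fun t ht h =>
    hsub ht ⟨hS t ⟨hc.1.trans_lt ht.1, ht.2.trans_le hxT⟩ h, ht.2.ne⟩
  have hs : Ioo c x ⊆ Icc 0 T := Ioo_subset_Icc_self.trans (Icc_subset_Icc hc.1 hxT)
  rcases forall_pos_or_forall_neg_of_ne_zero (f := fun t => M t * M' t)
    (((continuousOn_of_hasDerivWithinAt hM).mul hM').mono hs) h0 with h | h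
  · refine Or.inl ⟨leftSign_of_pos hc.2 h, ?_⟩
    filter_upwards [Ioo_mem_nhdsLT hc.2] with t ht
    exact abs_lt_abs_of_pos hM hc.1 hxT h (Ioo_subset_Icc_self ht) (right_mem_Icc.2 hc.2.le) ht.2
  · refine Or.inr ⟨leftSign_of_neg hc.2 h, ?_⟩
    filter_upwards [Ioo_mem_nhdsLT hc.2] with t ht
    exact abs_lt_abs_of_neg hM hc.1 hxT h (Ioo_subset_Icc_self ht) (right_mem_Icc.2 hc.2.le) ht.2

lemma eventually_nhdsWithin_Icc_interior {p : ℝ → Prop} {x : ℝ} (hx : x ∈ Ioo 0 T) (hp : p x) :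
    (∀ᶠ t in 𝓝[Icc 0 T] x, p t) ↔ (∀ᶠ t in 𝓝[<] x, p t) ∧ ∀ᶠ t in 𝓝[>] x, p t := by
  rw [nhdsWithin_eq_nhds.2 (Icc_mem_nhds hx.1 hx.2), ← nhdsNE_sup_pure, ← nhdsLT_sup_nhdsGT,
    eventually_sup, eventually_sup, eventually_pure]
  simp [hp]

lemma eventually_nhdsWithin_Icc_left {p : ℝ → Prop} (hT : 0 < T) (hp : p 0) :
    (∀ᶠ t in 𝓝[Icc 0 T] 0, p t) ↔ ∀ᶠ t in 𝓝[>] 0, p t := by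
  rw [nhdsWithin_Icc_eq_nhdsGE hT, ← Ioi_insert, nhdsWithin_insert, eventually_sup, eventually_pure]
  simp [hp]

lemma eventually_nhdsWithin_Icc_right {p : ℝ → Prop} (hT : 0 < T) (hp : p T) :
    (∀ᶠ t in 𝓝[Icc 0 T] T, p t) ↔ ∀ᶠ t in 𝓝[<] T, p t := by
  rw [nhdsWithin_Icc_eq_nhdsLE hT, ← Iio_insert, nhdsWithin_insert, eventually_sup, eventually_pure]
  simp [hp]

lemma eventually_le_iff_of_lt {l : Filter ℝ} [l.NeBot] {f : ℝ → ℝ} {y r : ℝ}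
    (h : (r = 1 ∧ ∀ᶠ t in l, y < f t) ∨ (r = -1 ∧ ∀ᶠ t in l, f t < y)) :
    ((∀ᶠ t in l, y ≤ f t) ↔ r = 1) ∧ ((∀ᶠ t in l, f t ≤ y) ↔ r = -1) := by
  rcases h with ⟨rfl, h⟩ | ⟨rfl, h⟩
  · refine ⟨by simpa using h.mono fun _ => le_of_lt, iff_of_false (fun h' => ?_) (by norm_num)⟩
    obtain ⟨t, h1, h2⟩ := (h.and h').exists
    exact absurd h1 h2.not_gt
  · refine ⟨iff_of_false (fun h' => ?_) (by norm_num), by simpa using h.mono fun _ => le_of_lt⟩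
    obtain ⟨t, h1, h2⟩ := (h.and h').exists
    exact absurd h1 h2.not_gt

/-- The total variation of `Φ(-|M|)` in terms of the zeros of `M` and the relative extrema
of `|M|`. -/
lemma integral_phi_mul_abs_deriv (hT : 0 < T)
    (hM : ∀ t ∈ Icc (0 : ℝ) T, HasDerivWithinAt M (M' t) (Icc 0 T) t)
    (hM' : ContinuousOn M' (Icc 0 T))
    (hzfin : {t | t ∈ Icc (0 : ℝ) T ∧ M t = 0}.Finite)
    (hzint : ∀ t ∈ Icc (0 : ℝ) T, M t = 0 → t ∈ Ioo (0 : ℝ) T)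
    (hcritfin : {t | t ∈ Icc (0 : ℝ) T ∧ M' t = 0}.Finite)
    (Emax Emin : Finset ℝ)
    (hEmax : ∀ x, x ∈ Emax ↔ (x ∈ Icc (0 : ℝ) T ∧ IsLocalMaxOn (fun t => |M t|) (Icc 0 T) x))
    (hEmin : ∀ x, x ∈ Emin ↔
      (x ∈ Icc (0 : ℝ) T ∧ M x ≠ 0 ∧ IsLocalMinOn (fun t => |M t|) (Icc 0 T) x)) :
    ∫ t in (0 : ℝ)..T, phi (M t) * |M' t| =
      ({t | t ∈ Icc (0 : ℝ) T ∧ M t = 0}.ncard : ℝ)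
      + (∑ x ∈ Emin, (if x = 0 ∨ x = T then (1 : ℝ) else 2) * Phi (-|M x|))
      - (∑ x ∈ Emax, (if x = 0 ∨ x = T then (1 : ℝ) else 2) * Phi (-|M x|)) := by
  classical
  set Zr := hzfin.toFinset with hZr
  set S : Finset ℝ := (Zr ∪ hcritfin.toFinset ∪ Emax ∪ Emin).filter (fun x => 0 < x ∧ x < T)
    with hSdef
  have hS : ∀ t ∈ Ioo 0 T, M t * M' t = 0 → t ∈ S := by
    intro t ht h
    have ht' := Ioo_subset_Icc_self ht
    rcases mul_eq_zero.1 h with h | h <;> simp [hSdef, hZr, h, ht.1, ht.2, ht'.1, ht'.2]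
  have hfilt : S.filter (fun x => 0 < x ∧ x < T) = S := by
    rw [hSdef, Finset.filter_filter]
    simp
  have h0S : (0 : ℝ) ∉ insert T S := by simp [hSdef, hT.ne]
  have hTS : T ∉ S := by simp [hSdef]
  set A : Finset ℝ := insert 0 (insert T S) with hA
  have hZA : Zr ⊆ A := by
    intro x hx
    have hx' := hzfin.mem_toFinset.1 hx
    have := hzint x hx'.1 hx'.2
    simp [hA, hSdef, this.1, this.2, hx]
  have hEA : ∀ x ∈ Icc 0 T, x ∈ Emax ∨ x ∈ Emin → x ∈ A := by
    intro x hx h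
    rcases hx.1.eq_or_lt with rfl | h1
    · simp [hA]
    rcases hx.2.eq_or_lt with rfl | h2
    · simp [hA]
    simp [hA, hSdef, h1, h2]
    tauto
  have hmaxA : Emax ⊆ A := fun x hx => hEA x ((hEmax x).1 hx).1 (Or.inl hx)
  have hminA : Emin ⊆ A := fun x hx => hEA x ((hEmin x).1 hx).1 (Or.inr hx)
  have hext : ∀ (E : Finset ℝ) (g : ℝ → ℝ), E ⊆ A →
      ∑ x ∈ E, g x = ∑ x ∈ A, if x ∈ E then g x else 0 := by
    intro E g hE
    rw [← Finset.sum_filter, Finset.filter_mem_eq_inter, Finset.inter_eq_right.2 hE]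
  have hcard : ({t | t ∈ Icc (0 : ℝ) T ∧ M t = 0}.ncard : ℝ) = ∑ x ∈ Zr, 2 * Phi (-|M x|) := by
    rw [Set.ncard_eq_toFinset_card _ hzfin, ← hZr, Finset.sum_congr rfl (g := fun _ => (1 : ℝ))]
    · simp
    · intro x hx
      rw [(hzfin.mem_toFinset.1 hx).2]
      simp [Phi_zero]
  rw [integral_phi_mul_abs_eq_sum hM hM' S hS _ 0 T le_rfl hT le_rfl rfl, hfilt, hcard,
    hext Zr _ hZA, hext Emin _ hminA, hext Emax _ hmaxA, ← Finset.sum_add_distrib,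
    ← Finset.sum_sub_distrib, hA, Finset.sum_insert h0S, Finset.sum_insert hTS]
  have hmin_iff : ∀ x, IsLocalMinOn (fun t => |M t|) (Icc 0 T) x ↔
      ∀ᶠ t in 𝓝[Icc 0 T] x, |M x| ≤ |M t| := fun x => Iff.rfl
  have hmax_iff : ∀ x, IsLocalMaxOn (fun t => |M t|) (Icc 0 T) x ↔
      ∀ᶠ t in 𝓝[Icc 0 T] x, |M t| ≤ |M x| := fun x => Iff.rfl
  have hZ_iff : ∀ x, x ∈ Zr ↔ x ∈ Icc 0 T ∧ M x = 0 := fun x => hzfin.mem_toFinset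
  have h0mem : (0 : ℝ) ∈ Icc 0 T := left_mem_Icc.2 hT.le
  have hTmem : T ∈ Icc 0 T := right_mem_Icc.2 hT.le
  have hM0 : M 0 ≠ 0 := fun h => lt_irrefl _ (hzint 0 h0mem h).1
  have hMT : M T ≠ 0 := fun h => lt_irrefl _ (hzint T hTmem h).2
  have e0 : rightSign (fun t => M t * M' t) 0 * Phi (-|M 0|) =
      (if 0 ∈ Zr then 2 * Phi (-|M 0|) else 0)
      + (if 0 ∈ Emin then (if (0 : ℝ) = 0 ∨ 0 = T then (1 : ℝ) else 2) * Phi (-|M 0|) else 0)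
      - (if 0 ∈ Emax then (if (0 : ℝ) = 0 ∨ 0 = T then (1 : ℝ) else 2) * Phi (-|M 0|) else 0) := by
    have hd := right_dichotomy hM hM' S hS le_rfl hT
    have he := eventually_le_iff_of_lt hd
    simp only [hZ_iff, hEmin, hEmax, hmin_iff, hmax_iff]
    rw [eventually_nhdsWithin_Icc_left (p := fun t => |M 0| ≤ |M t|) hT le_rfl,
      eventually_nhdsWithin_Icc_left (p := fun t => |M t| ≤ |M 0|) hT le_rfl,
      he.1, he.2]
    rcases hd with ⟨h, -⟩ | ⟨h, -⟩ <;> rw [h] <;> simp [hM0, hT.le] <;> norm_num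
  have eT : -(leftSign (fun t => M t * M' t) T * Phi (-|M T|)) =
      (if T ∈ Zr then 2 * Phi (-|M T|) else 0)
      + (if T ∈ Emin then (if T = 0 ∨ T = T then (1 : ℝ) else 2) * Phi (-|M T|) else 0)
      - (if T ∈ Emax then (if T = 0 ∨ T = T then (1 : ℝ) else 2) * Phi (-|M T|) else 0) := by
    have hd := left_dichotomy hM hM' S hS hT le_rfl
    have he := eventually_le_iff_of_lt (f := fun t => -|M t|) (y := -|M T|)
      (by simpa only [neg_lt_neg_iff] using hd)
    simp only [neg_le_neg_iff] at he
    simp only [hZ_iff, hEmin, hEmax, hmin_iff, hmax_iff]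
    rw [eventually_nhdsWithin_Icc_right (p := fun t => |M T| ≤ |M t|) hT le_rfl,
      eventually_nhdsWithin_Icc_right (p := fun t => |M t| ≤ |M T|) hT le_rfl,
      he.1, he.2]
    rcases hd with ⟨h, -⟩ | ⟨h, -⟩ <;> rw [h] <;> simp [hMT, hT.le] <;> norm_num
  rw [e0, sub_eq_add_neg, eT, Finset.sum_congr rfl, add_assoc]
  intro x hx
  have hxI : x ∈ Ioo 0 T := (Finset.mem_filter.1 hx).2
  have hdr := right_dichotomy hM hM' S hS hxI.1.le hxI.2
  have hdl := left_dichotomy hM hM' S hS hxI.1 hxI.2.le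
  have her := eventually_le_iff_of_lt hdr
  have hel := eventually_le_iff_of_lt (f := fun t => -|M t|) (y := -|M x|)
    (by simpa only [neg_lt_neg_iff] using hdl)
  simp only [neg_le_neg_iff] at hel
  simp only [hZ_iff, hEmin, hEmax, hmin_iff, hmax_iff]
  rw [eventually_nhdsWithin_Icc_interior (p := fun t => |M x| ≤ |M t|) hxI le_rfl,
      eventually_nhdsWithin_Icc_interior (p := fun t => |M t| ≤ |M x|) hxI le_rfl,
    her.1, her.2, hel.1, hel.2]
  have hxw : ¬ (x = 0 ∨ x = T) := by
    rintro (h | h)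
    · exact hxI.1.ne' h
    · exact hxI.2.ne h
  have hxIcc : x ∈ Icc 0 T := Ioo_subset_Icc_self hxI
  by_cases hMx : M x = 0
  · have hr : rightSign (fun t => M t * M' t) x = 1 := by
      rw [← her.1, hMx]
      simp
    have hl : leftSign (fun t => M t * M' t) x = -1 := by
      rw [← hel.2, hMx]
      simp
    simp only [hr, hl, hMx, hxIcc]
    norm_num
  · rcases hdr with ⟨hr, -⟩ | ⟨hr, -⟩ <;> rcases hdl with ⟨hl, -⟩ | ⟨hl, -⟩ <;>
      simp only [hr, hl, hxIcc, hxw] <;> norm_num [hMx]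

end Variation

lemma neBot_nhdsWithin_Icc_diff_singleton {T : ℝ} (hT : 0 < T) {t : ℝ} (ht : t ∈ Icc 0 T) :
    (𝓝[Icc 0 T \ {t}] t).NeBot := by
  have := uniqueDiffWithinAt_iff_accPt.1 (uniqueDiffOn_Icc hT t ht)
  rw [AccPt, nhdsWithin, inf_assoc, inf_principal] at this
  rw [nhdsWithin, Set.sdiff_eq, inter_comm]
  exact this

lemma tendsto_slope_straddle {E : Type*} [NormedAddCommGroup E] [NormedSpace ℝ E] {I : Set ℝ}
    {f : ℝ → E} {f' : E} {t : ℝ} (hf : HasDerivWithinAt f f' I t) {s u : ℕ → ℝ}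
    (hs : ∀ n, s n ∈ I) (hu : ∀ n, u n ∈ I) (hst : ∀ n, s n ≤ t) (htu : ∀ n, t ≤ u n)
    (hsu : ∀ n, s n < u n) (hlim : Tendsto (fun n => u n - s n) atTop (𝓝 0)) :
    Tendsto (fun n => (u n - s n)⁻¹ • (f (u n) - f (s n))) atTop (𝓝 f') := by
  have hs0 : Tendsto s atTop (𝓝[I] t) := by
    refine tendsto_nhdsWithin_iff.2 ⟨?_, Eventually.of_forall hs⟩
    refine tendsto_of_tendsto_of_tendsto_of_le_of_le (g := fun n => t - (u n - s n))
      (h := fun _ => t) (by simpa using hlim.const_sub t) tendsto_const_nhds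
      (fun n => ?_) hst
    have := htu n
    simp only
    linarith
  have hu0 : Tendsto u atTop (𝓝[I] t) := by
    refine tendsto_nhdsWithin_iff.2 ⟨?_, Eventually.of_forall hu⟩
    refine tendsto_of_tendsto_of_tendsto_of_le_of_le (g := fun _ => t)
      (h := fun n => t + (u n - s n)) tendsto_const_nhds (by simpa using hlim.const_add t)
      htu (fun n => ?_)
    have := hst n
    simp only
    linarith
  rw [Metric.tendsto_nhds]
  intro ε hε
  have ho := (hasDerivWithinAt_iff_isLittleO.1 hf).def (half_pos hε)
  filter_upwards [hs0.eventually ho, hu0.eventually ho] with n h1 h2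
  have hpos : 0 < u n - s n := sub_pos.2 (hsu n)
  have heq : (u n - s n)⁻¹ • (f (u n) - f (s n)) - f' =
      (u n - s n)⁻¹ • ((f (u n) - f t - (u n - t) • f') - (f (s n) - f t - (s n - t) • f')) := by
    have hf' : f' = (u n - s n)⁻¹ • ((u n - s n) • f') := by
      rw [smul_smul, inv_mul_cancel₀ hpos.ne', one_smul]
    conv_lhs => rw [hf']
    rw [← smul_sub]
    congr 1
    module
  rw [dist_eq_norm, heq, norm_smul, norm_inv, Real.norm_of_nonneg hpos.le, inv_mul_lt_iff₀ hpos]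
  rw [Real.norm_of_nonpos (sub_nonpos.2 (hst n))] at h1
  rw [Real.norm_of_nonneg (sub_nonneg.2 (htu n))] at h2
  calc _ ≤ _ := norm_sub_le _ _
    _ ≤ ε / 2 * (u n - t) + ε / 2 * -(s n - t) := add_le_add h2 h1
    _ = ε / 2 * (u n - s n) := by ring
    _ < (u n - s n) * ε := by nlinarith

lemma exists_sub_eq_mul_deriv {T : ℝ} {f f' : ℝ → ℝ}
    (hf : ∀ t ∈ Icc 0 T, HasDerivWithinAt f (f' t) (Icc 0 T) t) {a b : ℝ} (ha : a ∈ Icc 0 T)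
    (hb : b ∈ Icc 0 T) : ∃ c ∈ uIcc a b, f b - f a = (b - a) * f' c := by
  have key : ∀ a ∈ Icc 0 T, ∀ b ∈ Icc 0 T, a < b → ∃ c ∈ uIcc a b, f b - f a = (b - a) * f' c := by
    intro a ha b hb hab
    obtain ⟨c, hc, hc'⟩ := exists_hasDerivAt_eq_slope f f' hab
      (fun t ht => (hf t (Icc_subset_Icc ha.1 hb.2 ht)).continuousWithinAt.mono
        (Icc_subset_Icc ha.1 hb.2))
      (fun t ht => (hf t (Icc_subset_Icc ha.1 hb.2 (Ioo_subset_Icc_self ht))).hasDerivAt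
        (Icc_mem_nhds (ha.1.trans_lt ht.1) (ht.2.trans_le hb.2)))
    refine ⟨c, by rw [uIcc_of_le hab.le]; exact Ioo_subset_Icc_self hc, ?_⟩
    rw [hc', mul_div_cancel₀ _ (sub_pos.2 hab).ne']
  rcases lt_trichotomy a b with h | rfl | h
  · exact key a ha b hb h
  · exact ⟨a, by simp, by simp⟩
  · obtain ⟨c, hc, hc'⟩ := key b hb a ha h
    exact ⟨c, by rwa [uIcc_comm], by linarith⟩

lemma exists_mixed_difference_eq {T : ℝ} {Γ Γ₁ Γ₁₁ : ℝ → ℝ → ℝ}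
    (hΓ₁ : ∀ t ∈ Icc 0 T, ∀ s ∈ Icc (0 : ℝ) T,
      HasDerivWithinAt (fun u => Γ u t) (Γ₁ s t) (Icc 0 T) s)
    (hΓ₁₁ : ∀ s ∈ Icc 0 T, ∀ t ∈ Icc (0 : ℝ) T,
      HasDerivWithinAt (fun u => Γ₁ s u) (Γ₁₁ s t) (Icc 0 T) t)
    {s u s' u' : ℝ} (hs : s ∈ Icc 0 T) (hu : u ∈ Icc 0 T) (hs' : s' ∈ Icc 0 T)
    (hu' : u' ∈ Icc 0 T) :
    ∃ c ∈ uIcc s u, ∃ d ∈ uIcc s' u',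
      (Γ u u' - Γ u s') - (Γ s u' - Γ s s') = (u - s) * ((u' - s') * Γ₁₁ c d) := by
  obtain ⟨c, hc, h1⟩ := exists_sub_eq_mul_deriv (f := fun x => Γ x u' - Γ x s')
    (f' := fun x => Γ₁ x u' - Γ₁ x s')
    (fun x hx => (hΓ₁ u' hu' x hx).sub (hΓ₁ s' hs' x hx)) hs hu
  have hcI : c ∈ Icc 0 T := uIcc_subset_Icc hs hu hc
  obtain ⟨d, hd, h2⟩ := exists_sub_eq_mul_deriv (hΓ₁₁ c hcI) hs' hu'
  exact ⟨c, hc, d, hd, by rw [h1, h2]⟩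

section Hilbert

open scoped RealInnerProductSpace

variable {H : Type*} [NormedAddCommGroup H] [InnerProductSpace ℝ H]

/-- Mean-square differentiability: a curve in a Hilbert space whose Gram kernel has a mixed
derivative continuous at the diagonal is differentiable. -/
lemma exists_hasDerivWithinAt_of_mixed_deriv [CompleteSpace H] {T : ℝ} (hT : 0 < T)
    {Γ Γ₁ Γ₁₁ : ℝ → ℝ → ℝ}
    (hΓ₁ : ∀ t ∈ Icc 0 T, ∀ s ∈ Icc (0 : ℝ) T,
      HasDerivWithinAt (fun u => Γ u t) (Γ₁ s t) (Icc 0 T) s)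
    (hΓ₁₁ : ∀ s ∈ Icc 0 T, ∀ t ∈ Icc (0 : ℝ) T,
      HasDerivWithinAt (fun u => Γ₁ s u) (Γ₁₁ s t) (Icc 0 T) t)
    {Y : ℝ → H} (hY : ∀ s ∈ Icc 0 T, ∀ t ∈ Icc 0 T, ⟪Y s, Y t⟫ = Γ s t)
    {t : ℝ} (ht : t ∈ Icc 0 T)
    (hcont : ContinuousWithinAt (fun p : ℝ × ℝ => Γ₁₁ p.1 p.2) (Icc 0 T ×ˢ Icc 0 T) (t, t)) :
    ∃ V : H, HasDerivWithinAt Y V (Icc 0 T) t ∧ ‖V‖ ^ 2 = Γ₁₁ t t := by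
  set l : Filter ℝ := 𝓝[Icc 0 T \ {t}] t with hl
  have hne : l.NeBot := neBot_nhdsWithin_Icc_diff_singleton hT ht
  have hinner : Tendsto (fun q : ℝ × ℝ => ⟪slope Y t q.1, slope Y t q.2⟫) (l ×ˢ l)
      (𝓝 (Γ₁₁ t t)) := by
    rw [Metric.tendsto_nhds]
    intro ε hε
    obtain ⟨δ, hδ, hball⟩ := Metric.continuousWithinAt_iff.1 hcont ε hε
    have hmem : ∀ᶠ x in l, (x ∈ Icc 0 T ∧ x ≠ t) ∧ x ∈ Metric.ball t δ :=
      eventually_mem_nhdsWithin.and (mem_nhdsWithin_of_mem_nhds (Metric.ball_mem_nhds t hδ))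
    filter_upwards [hmem.prod_mk hmem] with q hq
    obtain ⟨⟨⟨h1, h1'⟩, h1b⟩, ⟨h2, h2'⟩, h2b⟩ := hq
    obtain ⟨c, hc, d, hd, heq⟩ := exists_mixed_difference_eq hΓ₁ hΓ₁₁ ht h1 ht h2
    have hval : ⟪slope Y t q.1, slope Y t q.2⟫ = Γ₁₁ c d := by
      have e1 : q.1 - t ≠ 0 := sub_ne_zero.2 h1'
      have e2 : q.2 - t ≠ 0 := sub_ne_zero.2 h2'
      simp only [slope, vsub_eq_sub, real_inner_smul_left, real_inner_smul_right, inner_sub_left,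
        inner_sub_right]
      rw [hY _ h1 _ h2, hY _ h1 _ ht, hY _ ht _ h2, hY _ ht _ ht]
      have heq' : Γ q.1 q.2 - Γ t q.2 - (Γ q.1 t - Γ t t) =
          (q.1 - t) * ((q.2 - t) * Γ₁₁ c d) := by rw [← heq]; ring
      rw [← mul_sub, heq']
      field_simp
    have hcb : c ∈ Metric.ball t δ :=
      (convex_ball t δ).ordConnected.uIcc_subset (Metric.mem_ball_self hδ) h1b hc
    have hdb : d ∈ Metric.ball t δ :=
      (convex_ball t δ).ordConnected.uIcc_subset (Metric.mem_ball_self hδ) h2b hd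
    rw [hval]
    refine hball (x := (c, d)) ⟨uIcc_subset_Icc ht h1 hc, uIcc_subset_Icc ht h2 hd⟩ ?_
    rw [Prod.dist_eq]
    exact max_lt hcb hdb
  have hdiag : Tendsto (fun x => ⟪slope Y t x, slope Y t x⟫) l (𝓝 (Γ₁₁ t t)) :=
    hinner.comp (tendsto_id.prodMk tendsto_id)
  have hcauchy : Cauchy (map (slope Y t) l) := by
    rw [cauchy_map_iff]
    refine ⟨hne, tendsto_uniformity_iff_dist_tendsto_zero.2 ?_⟩
    have h1 := ((hdiag.comp tendsto_fst).add (hdiag.comp tendsto_snd)).sub (hinner.const_mul 2)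
    have h2 := (Real.continuous_sqrt.tendsto _).comp h1
    have h0 : Γ₁₁ t t + Γ₁₁ t t - 2 * Γ₁₁ t t = 0 := by ring
    rw [h0, Real.sqrt_zero] at h2
    refine h2.congr fun q => ?_
    simp only [Function.comp_apply]
    rw [dist_eq_norm, ← Real.sqrt_sq (norm_nonneg (_ - _)), norm_sub_sq_real]
    simp only [real_inner_self_eq_norm_sq]
    congr 1
    ring
  obtain ⟨V, hV⟩ := CompleteSpace.complete hcauchy
  have hVt : Tendsto (slope Y t) l (𝓝 V) := hV
  refine ⟨V, hasDerivWithinAt_iff_tendsto_slope.2 hVt, ?_⟩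
  rw [← real_inner_self_eq_norm_sq]
  exact tendsto_nhds_unique (hVt.inner hVt) hdiag

lemma hasDerivWithinAt_normalize {I : Set ℝ} {Y : ℝ → H} {V : H} {t : ℝ}
    (hY : HasDerivWithinAt Y V I t) (h0 : Y t ≠ 0) :
    ∃ v : H, HasDerivWithinAt (fun s => ‖Y s‖⁻¹ • Y s) v I t ∧
      ‖v‖ ^ 2 = (‖V‖ ^ 2 - (⟪Y t, V⟫ / ‖Y t‖) ^ 2) / ‖Y t‖ ^ 2 ∧
      HasDerivWithinAt (fun s => ‖Y s‖) (⟪Y t, V⟫ / ‖Y t‖) I t := by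
  have hpos : 0 < ‖Y t‖ := norm_pos_iff.2 h0
  have h1 : HasDerivWithinAt (fun s => ‖Y s‖) (⟪Y t, V⟫ / ‖Y t‖) I t := by
    have := hY.norm_sq.sqrt (by positivity)
    simp only [Real.sqrt_sq (norm_nonneg _)] at this
    convert this using 1
    field_simp
  have h2 := (h1.fun_inv hpos.ne').fun_smul hY
  refine ⟨_, h2, ?_, h1⟩
  rw [norm_add_sq_real]
  simp only [norm_smul, real_inner_smul_left, real_inner_smul_right, mul_pow, Real.norm_eq_abs,
    sq_abs, real_inner_comm (Y t) V]
  field_simp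
  ring

end Hilbert

lemma setOf_mul_neg_eq_Ioo {a d r : ℝ} (hr : 0 < r) :
    {x : ℝ | (a + x) * (d + r * x) < 0} = Ioo (min (-a) (-d / r)) (max (-a) (-d / r)) := by
  ext x
  have h1 : x < -d / r ↔ d + r * x < 0 := by
    rw [lt_div_iff₀ hr]; constructor <;> intro h <;> linarith
  have h2 : -d / r < x ↔ 0 < d + r * x := by
    rw [div_lt_iff₀ hr]; constructor <;> intro h <;> linarith
  have h3 : x < -a ↔ a + x < 0 := by constructor <;> intro h <;> linarith
  have h4 : -a < x ↔ 0 < a + x := by constructor <;> intro h <;> linarith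
  simp only [mem_ofPred_eq, mem_Ioo, min_lt_iff, lt_max_iff, h1, h2, h3, h4, mul_neg_iff]
  constructor
  · rintro (h | h)
    · exact ⟨Or.inl h.1, Or.inr h.2⟩
    · exact ⟨Or.inr h.2, Or.inl h.1⟩
  · rintro ⟨h | h, h' | h'⟩
    · linarith
    · exact Or.inl ⟨h, h'⟩
    · exact Or.inr ⟨h', h⟩
    · linarith

/-- The probability that two jointly Gaussian variables with unit variances and correlation
`r > 0` have opposite signs. -/
lemma measure_mul_neg_of_hasGaussianLaw {Ω : Type*} [MeasurableSpace Ω] {P : Measure Ω}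
    {A B : Ω → ℝ} (hAB : HasGaussianLaw (fun ω => (A ω, B ω)) P) {a b r : ℝ}
    (hA : Measurable A) (hB : Measurable B)
    (ha : P[A] = a) (hb : P[B] = b) (hvA : Var[A; P] = 1) (hvB : Var[B; P] = 1)
    (hcov : cov[A, B; P] = r) (hr : 0 < r) (hr1 : r ≤ 1) :
    P {ω | A ω * B ω < 0} =
      ∫⁻ y, ENNReal.ofReal |Phi (-(b + √(1 - r ^ 2) * y) / r) - Phi (-a)| ∂(gaussianReal 0 1) := by
  have := hAB.isProbabilityMeasure
  have hA2 : MemLp A 2 P := hAB.fst.memLp_two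
  have hB2 : MemLp B 2 P := hAB.snd.memLp_two
  set W : Ω → ℝ := fun ω => B ω - r * A ω with hW
  have hAW : HasGaussianLaw (fun ω => (A ω, W ω)) P :=
    hAB.map_fun ((ContinuousLinearMap.fst ℝ ℝ ℝ).prod
      (ContinuousLinearMap.snd ℝ ℝ ℝ - r • ContinuousLinearMap.fst ℝ ℝ ℝ))
  have hWm : Measurable W := hB.sub (hA.const_mul r)
  have hrA2 : MemLp (fun ω => r * A ω) 2 P := hA2.const_mul r
  have hcovW : cov[A, W; P] = 0 := by
    have : W = B - fun ω => r * A ω := rfl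
    rw [this, covariance_sub_right hA2 hB2 hrA2, covariance_const_mul_right, hcov,
      covariance_self hA.aemeasurable, hvA]
    ring
  have hind := hAW.indepFun_of_covariance_eq_zero hcovW
  have hEW : P[W] = b - r * a := by
    simp only [hW]
    rw [MeasureTheory.integral_sub hAB.snd.integrable (hAB.fst.integrable.const_mul r),
      MeasureTheory.integral_const_mul, ha, hb]
  have hvW : Var[W; P] = 1 - r ^ 2 := by
    have : W = B - fun ω => r * A ω := rfl
    rw [this, variance_sub hB2 hrA2, variance_const_mul, covariance_const_mul_right,
      covariance_comm, hcov, hvA, hvB]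
    ring
  have hr2 : 0 ≤ 1 - r ^ 2 := by nlinarith
  have hmapA : P.map A = (gaussianReal 0 1).map (fun x => a + x) := by
    rw [hAB.fst.map_eq_gaussianReal, ha, hvA, gaussianReal_map_const_add]
    simp
  have hmapW : P.map W = (gaussianReal 0 1).map (fun y => (b - r * a) + √(1 - r ^ 2) * y) := by
    have : (fun y => (b - r * a) + √(1 - r ^ 2) * y) =
      (fun y => (b - r * a) + y) ∘ (fun y => √(1 - r ^ 2) * y) := rfl
    rw [hAW.snd.map_eq_gaussianReal, hEW, hvW, this, ← Measure.map_map (by fun_prop) (by fun_prop),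
      gaussianReal_map_const_mul, gaussianReal_map_const_add]
    congr 1
    · simp
    · ext
      simp [Real.sq_sqrt hr2, hr2]
  have hmeas : MeasurableSet {p : ℝ × ℝ | p.1 * (p.2 + r * p.1) < 0} :=
    measurableSet_lt (by fun_prop) measurable_const
  have hset : {ω | A ω * B ω < 0} = (fun ω => (A ω, W ω)) ⁻¹'
      {p : ℝ × ℝ | p.1 * (p.2 + r * p.1) < 0} := by
    ext ω
    simp [hW]
  rw [hset, ← Measure.map_apply (hA.prodMk hWm) hmeas,
    (indepFun_iff_map_prod_eq_prod_map_map hA.aemeasurable hWm.aemeasurable).1 hind,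
    hmapA, hmapW, Measure.map_prod_map _ _ (by fun_prop) (by fun_prop),
    Measure.map_apply (by fun_prop) hmeas, Measure.prod_apply_symm (hmeas.preimage (by fun_prop))]
  refine lintegral_congr fun y => ?_
  rw [← gaussianReal_uIoo, ← max_comm, ← min_comm]
  congr 1
  rw [min_comm, max_comm, ← setOf_mul_neg_eq_Ioo hr]
  ext x
  simp only [mem_preimage, mem_ofPred_eq, Prod.map_apply]
  rw [show b - r * a + √(1 - r ^ 2) * y + r * (a + x) = b + √(1 - r ^ 2) * y + r * x by ring]

/-- The left endpoint of the cell containing `t` in the grid of mesh `h`. -/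
lemma cell_mem {T : ℝ} (hT : 0 < T) {t : ℝ} (ht : t ∈ Ico 0 T) (n : ℕ) :
    (⌊t / (T / (n + 1))⌋₊ : ℝ) * (T / (n + 1)) ≤ t ∧
      t < (⌊t / (T / (n + 1))⌋₊ + 1 : ℝ) * (T / (n + 1)) ∧
      ⌊t / (T / (n + 1))⌋₊ < n + 1 := by
  have hn : (0 : ℝ) < n + 1 := by positivity
  have hh : 0 < T / (n + 1) := by positivity
  have h0 : 0 ≤ t / (T / (n + 1)) := div_nonneg ht.1 hh.le
  refine ⟨?_, ?_, ?_⟩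
  · rw [← le_div_iff₀ hh]; exact Nat.floor_le h0
  · rw [← div_lt_iff₀ hh]; exact Nat.lt_floor_add_one _
  · rw [Nat.floor_lt h0, div_lt_iff₀ hh]
    push_cast
    rw [mul_div_cancel₀ _ hn.ne']
    exact ht.2

lemma grid_mem_Icc {T : ℝ} (hT : 0 < T) {n k : ℕ} (hk : k ≤ n + 1) :
    (k : ℝ) * (T / (n + 1)) ∈ Icc 0 T := by
  have hn : (0 : ℝ) < n + 1 := by positivity
  have hk' : (k : ℝ) ≤ n + 1 := by exact_mod_cast hk
  refine ⟨by positivity, ?_⟩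
  rw [mul_div_assoc', div_le_iff₀ hn]
  nlinarith

lemma floor_eq_of_mem_cell {h t : ℝ} (hh : 0 < h) {k : ℕ}
    (ht : t ∈ Ioo ((k : ℝ) * h) (((k + 1 : ℕ) : ℝ) * h)) : ⌊t / h⌋₊ = k := by
  rw [Nat.floor_eq_iff (div_nonneg (le_trans (by positivity) ht.1.le) hh.le), le_div_iff₀ hh,
    div_lt_iff₀ hh]
  exact ⟨ht.1.le, by exact_mod_cast ht.2⟩

lemma tendsto_mesh (T : ℝ) : Tendsto (fun n : ℕ => T / ((n : ℝ) + 1)) atTop (𝓝 0) :=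
  tendsto_const_nhds.div_atTop
    (tendsto_atTop_add_const_right _ _ tendsto_natCast_atTop_atTop)

/-- Convergence of sums over the cells of the uniform grids of `[0, T]` to an integral. -/
lemma tendsto_sum_range_of_tendsto_cell {T : ℝ} (hT : 0 < T) {p : ℕ → ℕ → ℝ} {C : ℝ} {G : ℝ → ℝ}
    (hb : ∀ᶠ n : ℕ in atTop, ∀ k < n + 1, |p n k| ≤ C * (T / (n + 1)))
    (hl : ∀ t ∈ Ico 0 T, Tendsto
      (fun n : ℕ => (T / ((n : ℝ) + 1))⁻¹ * p n ⌊t / (T / (n + 1))⌋₊) atTop (𝓝 (G t))) :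
    IntervalIntegrable G volume 0 T ∧
      Tendsto (fun n => ∑ k ∈ Finset.range (n + 1), p n k) atTop (𝓝 (∫ t in (0 : ℝ)..T, G t)) := by
  set g : ℕ → ℝ → ℝ := fun n t => (T / ((n : ℝ) + 1))⁻¹ * p n ⌊t / (T / (n + 1))⌋₊ with hg
  have hgm : ∀ n, Measurable (g n) := fun n =>
    ((measurable_from_nat (f := p n)).comp
      (Nat.measurable_floor.comp (measurable_id.div_const _))).const_mul _
  have hae : ∀ᵐ t ∂(volume : Measure ℝ), t ≠ T := by
    simp [ae_iff, measure_singleton]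
  have hlim : ∀ᵐ t ∂(volume.restrict (uIoc 0 T)), Tendsto (fun n => g n t) atTop (𝓝 (G t)) := by
    rw [ae_restrict_iff' measurableSet_uIoc]
    filter_upwards [hae] with t htT ht
    rw [uIoc_of_le hT.le] at ht
    exact hl t ⟨ht.1.le, lt_of_le_of_ne ht.2 htT⟩
  have hbd : ∀ᶠ n in atTop, ∀ᵐ t ∂volume, t ∈ uIoc 0 T → ‖g n t‖ ≤ C := by
    filter_upwards [hb] with n hn
    filter_upwards [hae] with t htT ht
    rw [uIoc_of_le hT.le] at ht
    have hh : 0 < T / ((n : ℝ) + 1) := by positivity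
    have := hn _ (cell_mem hT ⟨ht.1.le, lt_of_le_of_ne ht.2 htT⟩ n).2.2
    simp only [hg]
    rw [norm_mul, norm_inv, Real.norm_of_nonneg hh.le, Real.norm_eq_abs, inv_mul_le_iff₀ hh]
    linarith
  have hInt : ∀ n, ∫ t in (0 : ℝ)..T, g n t = ∑ k ∈ Finset.range (n + 1), p n k := by
    intro n
    have hh : 0 < T / ((n : ℝ) + 1) := by positivity
    have hcell : ∀ k : ℕ, ∀ t ∈ Ioo ((k : ℝ) * (T / (n + 1))) (((k + 1 : ℕ) : ℝ) * (T / (n + 1))),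
        g n t = (T / ((n : ℝ) + 1))⁻¹ * p n k := by
      intro k t ht
      simp only [hg]
      rw [floor_eq_of_mem_cell hh ht]
    have hle : ∀ k : ℕ, (k : ℝ) * (T / (n + 1)) ≤ ((k + 1 : ℕ) : ℝ) * (T / (n + 1)) := by
      intro k
      gcongr
      simp
    have hsum := sum_integral_adjacent_intervals (μ := volume) (f := g n)
      (a := fun k : ℕ => (k : ℝ) * (T / (n + 1))) (n := n + 1) (fun k _ => by
        rw [intervalIntegrable_iff_integrableOn_Ioo_of_le (hle k)]
        exact (integrableOn_const (by simp)).congr_fun (fun t ht => (hcell k t ht).symm)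
          measurableSet_Ioo)
    have hend : ((n + 1 : ℕ) : ℝ) * (T / (n + 1)) = T := by
      push_cast
      rw [mul_div_cancel₀ _ (by positivity)]
    simp only [hend, Nat.cast_zero, zero_mul] at hsum
    rw [← hsum]
    refine Finset.sum_congr rfl fun k _ => ?_
    rw [integral_of_le (hle k), integral_Ioc_eq_integral_Ioo,
      setIntegral_congr_fun measurableSet_Ioo (hcell k), setIntegral_const]
    simp only [measureReal_def, Real.volume_Ioo, smul_eq_mul]
    rw [ENNReal.toReal_ofReal (sub_nonneg.2 (hle k))]
    push_cast
    field_simp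
    ring
  have hGm : AEStronglyMeasurable G (volume.restrict (uIoc 0 T)) :=
    aestronglyMeasurable_of_tendsto_ae atTop (fun n => (hgm n).aestronglyMeasurable) hlim
  refine ⟨?_, ?_⟩
  · have : IsFiniteMeasure (volume.restrict (uIoc 0 T)) := ⟨by simp [uIoc_of_le hT.le]⟩
    rw [intervalIntegrable_iff]
    refine Integrable.of_bound (C := C) hGm ?_
    obtain ⟨N, hN⟩ := eventually_atTop.1 hbd
    have hall : ∀ᵐ t ∂volume.restrict (uIoc 0 T), ∀ n ≥ N, ‖g n t‖ ≤ C := by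
      rw [ae_all_iff]
      intro n
      by_cases hn : n ≥ N
      · rw [ae_restrict_iff' measurableSet_uIoc]
        filter_upwards [hN n hn] with t ht ht' _ using ht ht'
      · exact Eventually.of_forall fun t h => absurd h hn
    filter_upwards [hall, hlim] with t h1 h2
    exact le_of_tendsto h2.norm (eventually_atTop.2 ⟨N, h1⟩)
  · simp_rw [← hInt]
    refine intervalIntegral.tendsto_integral_filter_of_dominated_convergence (fun _ => C)
      (Eventually.of_forall fun n => (hgm n).aestronglyMeasurable) hbd
      intervalIntegrable_const ?_
    exact (ae_restrict_iff' measurableSet_uIoc).1 hlim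

lemma HasStrictDerivAt.tendsto_inv_mul_sub {f : ℝ → ℝ} {f' a c : ℝ} (hf : HasStrictDerivAt f f' a)
    {A B h : ℕ → ℝ} (hA : Tendsto A atTop (𝓝 a)) (hB : Tendsto B atTop (𝓝 a))
    (hh : ∀ n, h n ≠ 0) (hc : Tendsto (fun n => (h n)⁻¹ * (B n - A n)) atTop (𝓝 c)) :
    Tendsto (fun n => (h n)⁻¹ * (f (B n) - f (A n))) atTop (𝓝 (f' * c)) := by
  have h1 := hf.hasStrictFDerivAt.isLittleO.comp_tendsto (hB.prodMk_nhds hA)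
  have h2 : (fun n => B n - A n) =O[atTop] h := by
    have := hc.isBigO_one ℝ |>.mul (Asymptotics.isBigO_refl h atTop)
    refine this.congr (fun n => ?_) (fun n => one_mul _)
    have := hh n
    field_simp
  have h3 := (h1.trans_isBigO h2).tendsto_div_nhds_zero
  have h4 := h3.add (hc.const_mul f')
  rw [zero_add] at h4
  refine h4.congr fun n => ?_
  have := hh n
  simp only [Function.comp_apply, ContinuousLinearMap.toSpanSingleton_apply, smul_eq_mul]
  field_simp
  ring

section Cross

open scoped RealInnerProductSpace

variable {H : Type*} [NormedAddCommGroup H] [InnerProductSpace ℝ H]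

/-- The conditional probability of a sign change between two standardized Gaussian variables with
means `a`, `b` and correlation `r`, given the value `x` of the normalized innovation. -/
noncomputable def crossKernel (a b r x : ℝ) : ℝ :=
  |Phi (-(b + √(1 - r ^ 2) * x) / r) - Phi (-a)|

lemma continuous_crossKernel (a b r : ℝ) : Continuous (crossKernel a b r) := by
  unfold crossKernel
  have := continuous_Phi
  fun_prop

lemma one_sub_inner_of_norm_eq_one {y z : H} (hy : ‖y‖ = 1) (hz : ‖z‖ = 1) :
    1 - ⟪y, z⟫ = ‖z - y‖ ^ 2 / 2 := by
  rw [norm_sub_sq_real, hy, hz, real_inner_comm]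
  ring

lemma inner_le_one_of_norm_eq_one {y z : H} (hy : ‖y‖ = 1) (hz : ‖z‖ = 1) : ⟪y, z⟫ ≤ 1 := by
  have := one_sub_inner_of_norm_eq_one hy hz
  have := sq_nonneg ‖z - y‖
  linarith

lemma half_le_inner_of_norm_sub_le {y z : H} (hy : ‖y‖ = 1) (hz : ‖z‖ = 1) (h : ‖z - y‖ ≤ 1) :
    1 / 2 ≤ ⟪y, z⟫ := by
  have := one_sub_inner_of_norm_eq_one hy hz
  have : ‖z - y‖ ^ 2 ≤ 1 := pow_le_one₀ (norm_nonneg _) h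
  linarith

lemma sqrt_one_sub_inner_sq {y z : H} (hy : ‖y‖ = 1) (hz : ‖z‖ = 1) :
    √(1 - ⟪y, z⟫ ^ 2) = ‖z - y‖ * √((1 + ⟪y, z⟫) / 2) := by
  have h : 1 - ⟪y, z⟫ ^ 2 = ‖z - y‖ ^ 2 * ((1 + ⟪y, z⟫) / 2) := by
    have := one_sub_inner_of_norm_eq_one hy hz
    calc _ = (1 - ⟪y, z⟫) * (1 + ⟪y, z⟫) := by ring
      _ = _ := by rw [this]; ring
  rw [h, Real.sqrt_mul (sq_nonneg _), Real.sqrt_sq (norm_nonneg _)]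

lemma crossKernel_le {y z : H} (hy : ‖y‖ = 1) (hz : ‖z‖ = 1) {K h a b : ℝ}
    (hyz : ‖z - y‖ ≤ K * h) (hab : |b - a| ≤ K * h) (ha : |a| ≤ K) (hKh : K * h ≤ 1) (x : ℝ) :
    crossKernel a b ⟪y, z⟫ x ≤ 2 * K * (1 + K) * (1 + |x|) * h := by
  have hr := half_le_inner_of_norm_sub_le hy hz (hyz.trans hKh)
  have hr1 := inner_le_one_of_norm_eq_one hy hz
  have hρ : √(1 - ⟪y, z⟫ ^ 2) ≤ K * h := by
    rw [sqrt_one_sub_inner_sq hy hz]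
    have : √((1 + ⟪y, z⟫) / 2) ≤ 1 := Real.sqrt_le_one.2 (by linarith)
    calc _ ≤ ‖z - y‖ * 1 := by gcongr
      _ ≤ _ := by linarith
  have h1r : 1 - ⟪y, z⟫ ≤ K * h := by
    rw [one_sub_inner_of_norm_eq_one hy hz]
    nlinarith [norm_nonneg (z - y)]
  have h1r0 : 0 ≤ 1 - ⟪y, z⟫ := by linarith
  have hK : 0 ≤ K := (abs_nonneg _).trans ha
  have hKh0 : 0 ≤ K * h := (norm_nonneg _).trans hyz
  generalize ⟪y, z⟫ = r at *
  have hrpos : 0 < r := by linarith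
  refine (abs_Phi_sub_le _ _).trans ?_
  have heq : -(b + √(1 - r ^ 2) * x) / r - -a =
      -((b - a) + √(1 - r ^ 2) * x + (1 - r) * a) / r := by
    field_simp
    ring
  rw [heq, abs_div, abs_neg, abs_of_pos hrpos, div_le_iff₀ hrpos]
  have hnum : |(b - a) + √(1 - r ^ 2) * x + (1 - r) * a| ≤ K * h + K * h * |x| + K * h * K := by
    refine (abs_add_le _ _).trans (add_le_add ((abs_add_le _ _).trans (add_le_add hab ?_)) ?_)
    · rw [abs_mul, abs_of_nonneg (Real.sqrt_nonneg _)]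
      gcongr
    · rw [abs_mul, abs_of_nonneg h1r0]
      gcongr
  have hx := abs_nonneg x
  calc _ ≤ _ := hnum
    _ ≤ K * h * ((1 + K) * (1 + |x|)) := by
      have : 0 ≤ K * h * (K * |x|) := by positivity
      nlinarith
    _ = (2 * (K * h) * ((1 + K) * (1 + |x|))) * (1 / 2) := by ring
    _ ≤ (2 * (K * h) * ((1 + K) * (1 + |x|))) * r := by gcongr
    _ = _ := by ring

/-- The local intensity of sign changes along shrinking cells containing `t`. -/
lemma tendsto_inv_mul_integral_crossKernel {I : Set ℝ} {y : ℝ → H} {v : H} {M : ℝ → ℝ} {M' t K : ℝ}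
    (hyn : ∀ s ∈ I, ‖y s‖ = 1) (hy : HasDerivWithinAt y v I t) (hM : HasDerivWithinAt M M' I t)
    (htI : t ∈ I) (hK : ∀ s ∈ I, ∀ u ∈ I, ‖y u - y s‖ ≤ K * |u - s| ∧ |M u - M s| ≤ K * |u - s|)
    (hMK : ∀ s ∈ I, |M s| ≤ K) {s u : ℕ → ℝ}
    (hs : ∀ n, s n ∈ I) (hu : ∀ n, u n ∈ I) (hst : ∀ n, s n ≤ t) (htu : ∀ n, t ≤ u n)
    (hsu : ∀ n, s n < u n) (hlim : Tendsto (fun n => u n - s n) atTop (𝓝 0)) :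
    Tendsto (fun n => (u n - s n)⁻¹ *
        ∫ x, crossKernel (M (s n)) (M (u n)) ⟪y (s n), y (u n)⟫ x ∂(gaussianReal 0 1)) atTop
      (𝓝 (phi (M t) * ∫ x, |M' + ‖v‖ * x| ∂(gaussianReal 0 1))) := by
  have hpos : ∀ n, 0 < u n - s n := fun n => sub_pos.2 (hsu n)
  have hyslope := tendsto_slope_straddle hy hs hu hst htu hsu hlim
  have hMslope := tendsto_slope_straddle hM hs hu hst htu hsu hlim
  have hs0 : Tendsto s atTop (𝓝[I] t) := by
    refine tendsto_nhdsWithin_iff.2 ⟨?_, Eventually.of_forall hs⟩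
    refine tendsto_of_tendsto_of_tendsto_of_le_of_le (g := fun n => t - (u n - s n))
      (h := fun _ => t) (by simpa using hlim.const_sub t) tendsto_const_nhds
      (fun n => ?_) hst
    have := htu n
    simp only
    linarith
  have hu0 : Tendsto u atTop (𝓝[I] t) := by
    refine tendsto_nhdsWithin_iff.2 ⟨?_, Eventually.of_forall hu⟩
    refine tendsto_of_tendsto_of_tendsto_of_le_of_le (g := fun _ => t)
      (h := fun n => t + (u n - s n)) tendsto_const_nhds (by simpa using hlim.const_add t)
      htu (fun n => ?_)
    have := hst n
    simp only
    linarith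
  have hMs : Tendsto (fun n => M (s n)) atTop (𝓝 (M t)) := hM.continuousWithinAt.tendsto.comp hs0
  have hMu : Tendsto (fun n => M (u n)) atTop (𝓝 (M t)) := hM.continuousWithinAt.tendsto.comp hu0
  have hr : Tendsto (fun n => ⟪y (s n), y (u n)⟫) atTop (𝓝 1) := by
    have h := (hy.continuousWithinAt.tendsto.comp hs0).inner (𝕜 := ℝ)
      (hy.continuousWithinAt.tendsto.comp hu0)
    rwa [real_inner_self_eq_norm_sq, hyn t htI, one_pow] at h
  have hnslope : Tendsto (fun n => (u n - s n)⁻¹ * ‖y (u n) - y (s n)‖) atTop (𝓝 ‖v‖) := by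
    refine hyslope.norm.congr fun n => ?_
    rw [norm_smul, norm_inv, Real.norm_of_nonneg (hpos n).le]
  have hρ : Tendsto (fun n => (u n - s n)⁻¹ * √(1 - ⟪y (s n), y (u n)⟫ ^ 2)) atTop (𝓝 ‖v‖) := by
    have h1 : Tendsto (fun n => √((1 + ⟪y (s n), y (u n)⟫) / 2)) atTop (𝓝 1) := by
      have := ((hr.const_add 1).div_const 2).sqrt
      rwa [show √(((1 : ℝ) + 1) / 2) = 1 by norm_num] at this
    have h2 := hnslope.mul h1
    rw [mul_one] at h2
    refine h2.congr fun n => ?_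
    rw [sqrt_one_sub_inner_sq (hyn _ (hs n)) (hyn _ (hu n)), mul_assoc]
  have h1r : Tendsto (fun n => (u n - s n)⁻¹ * (1 - ⟪y (s n), y (u n)⟫)) atTop (𝓝 0) := by
    have h2 := (hnslope.mul hnslope).mul (hlim.div_const 2)
    rw [zero_div, mul_zero] at h2
    refine h2.congr fun n => ?_
    rw [one_sub_inner_of_norm_eq_one (hyn _ (hs n)) (hyn _ (hu n))]
    have := (hpos n).ne'
    field_simp
  have hKh : Tendsto (fun n => K * (u n - s n)) atTop (𝓝 0) := by simpa using hlim.const_mul K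
  have hev : ∀ᶠ n in atTop, K * (u n - s n) ≤ 1 := hKh.eventually_le_const one_pos
  simp_rw [← MeasureTheory.integral_const_mul]
  refine tendsto_integral_filter_of_dominated_convergence
    (fun x => 2 * K * (1 + K) * (1 + |x|)) ?_ ?_ ?_ ?_
  · exact Eventually.of_forall fun n =>
      ((continuous_crossKernel _ _ _).const_mul _).aestronglyMeasurable
  · filter_upwards [hev] with n hn
    refine Eventually.of_forall fun x => ?_
    have hk := hK _ (hs n) _ (hu n)
    rw [abs_of_pos (hpos n)] at hk
    have := crossKernel_le (hyn _ (hs n)) (hyn _ (hu n)) hk.1 hk.2 (hMK _ (hs n)) hn x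
    rw [norm_mul, norm_inv, Real.norm_of_nonneg (hpos n).le, inv_mul_le_iff₀ (hpos n),
      Real.norm_of_nonneg (by unfold crossKernel; positivity)]
    linarith
  · exact (((integrable_const 1).add integrable_id_gaussianReal.abs)).const_mul _
  · refine Eventually.of_forall fun x => ?_
    have hslope : Tendsto (fun n => (u n - s n)⁻¹ *
        (-(M (u n) + √(1 - ⟪y (s n), y (u n)⟫ ^ 2) * x) / ⟪y (s n), y (u n)⟫ - -M (s n)))
        atTop (𝓝 (-(M' + ‖v‖ * x))) := by
      have h3 := (((hMslope.add (hρ.mul_const x)).add (h1r.mul hMs)).neg).div hr one_ne_zero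
      rw [zero_mul, add_zero, div_one] at h3
      have hr0 : ∀ᶠ n in atTop, 0 < ⟪y (s n), y (u n)⟫ := hr.eventually_const_lt one_pos
      refine h3.congr' ?_
      filter_upwards [hr0] with n hn
      have := (hpos n).ne'
      simp only [Pi.div_apply, smul_eq_mul]
      field_simp
      ring
    have hB : Tendsto (fun n =>
        -(M (u n) + √(1 - ⟪y (s n), y (u n)⟫ ^ 2) * x) / ⟪y (s n), y (u n)⟫) atTop (𝓝 (-M t)) := by
      have h3 := (hslope.mul hlim).add hMs.neg
      rw [mul_zero, zero_add] at h3
      refine h3.congr fun n => ?_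
      have := (hpos n).ne'
      field_simp
      ring
    have h4 := ((hasStrictDerivAt_Phi (-M t)).tendsto_inv_mul_sub hMs.neg hB
      (fun n => (hpos n).ne') hslope).abs
    rw [abs_mul, phi_neg, abs_of_pos (phi_pos _), abs_neg] at h4
    refine h4.congr fun n => ?_
    rw [abs_mul, abs_of_pos (inv_pos.2 (hpos n))]
    rfl

end Cross

section Crossings

/-- The number of cells of the uniform grid with `n + 1` cells on `[0, T]` across which `z` changes
sign. -/
noncomputable def signChangeCount (T : ℝ) (z : ℝ → ℝ) (n : ℕ) : ℕ :=
  ((Finset.range (n + 1)).filter fun k : ℕ => z ((k : ℝ) * (T / (n + 1))) *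
    z (((k + 1 : ℕ) : ℝ) * (T / (n + 1))) < 0).card

variable {T : ℝ} {z z' : ℝ → ℝ}

lemma finite_zeros_of_deriv_ne_zero
    (hz : ∀ s ∈ Icc 0 T, HasDerivWithinAt z (z' s) (Icc 0 T) s)
    (hsimple : ∀ s ∈ Icc 0 T, z s = 0 → z' s ≠ 0) : {t | t ∈ Icc 0 T ∧ z t = 0}.Finite := by
  by_contra hinf
  obtain ⟨t, ht, hacc⟩ := Set.Infinite.exists_accPt_of_subset_isCompact hinf
    (isCompact_Icc (a := (0 : ℝ)) (b := T)) (fun t ht => ht.1)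
  have hfreq := accPt_iff_frequently_nhdsNE.1 hacc
  have hzt : z t = 0 := by
    by_contra hne
    have h1 : ∀ᶠ s in 𝓝[Icc 0 T] t, z s ≠ 0 :=
      (hz t ht).continuousWithinAt.eventually_ne hne
    rw [eventually_nhdsWithin_iff] at h1
    obtain ⟨s, hs, hs'⟩ := (hfreq.and_eventually (nhdsWithin_le_nhds h1)).exists
    exact hs' hs.1 hs.2
  have h2 := (hz t ht).eventually_ne (hsimple t ht hzt) (c := 0)
  rw [Set.sdiff_eq, inter_comm, nhdsWithin_inter', eventually_inf_principal] at h2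
  obtain ⟨s, hs, hs'⟩ := (hfreq.and_eventually h2).exists
  exact hs' hs.1 hs.2

lemma signChangeCount_le_ncard (hT : 0 < T) (hz : ContinuousOn z (Icc 0 T))
    (hfin : {t | t ∈ Icc 0 T ∧ z t = 0}.Finite) (n : ℕ) :
    signChangeCount T z n ≤ {t | t ∈ Icc 0 T ∧ z t = 0}.ncard := by
  have hh : 0 < T / ((n : ℝ) + 1) := by positivity
  have key : ∀ k ∈ (Finset.range (n + 1)).filter fun k : ℕ => z ((k : ℝ) * (T / (n + 1))) *
      z (((k + 1 : ℕ) : ℝ) * (T / (n + 1))) < 0,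
      ∃ t ∈ Ioo ((k : ℝ) * (T / (n + 1))) (((k + 1 : ℕ) : ℝ) * (T / (n + 1))),
        t ∈ Icc 0 T ∧ z t = 0 := by
    intro k hk
    rw [Finset.mem_filter, Finset.mem_range] at hk
    have hkI := grid_mem_Icc hT (n := n) (k := k) (by omega)
    have hkI' := grid_mem_Icc hT (n := n) (k := k + 1) (by omega)
    have hle : (k : ℝ) * (T / (n + 1)) ≤ ((k + 1 : ℕ) : ℝ) * (T / (n + 1)) := by
      gcongr
      simp
    have hsub := Icc_subset_Icc hkI.1 hkI'.2
    have hcont := hz.mono hsub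
    rcases mul_neg_iff.1 hk.2 with ⟨h1, h2⟩ | ⟨h1, h2⟩
    · obtain ⟨t, ht, ht0⟩ := intermediate_value_Ioo' hle hcont ⟨h2, h1⟩
      exact ⟨t, ht, hsub (Ioo_subset_Icc_self ht), ht0⟩
    · obtain ⟨t, ht, ht0⟩ := intermediate_value_Ioo hle hcont ⟨h1, h2⟩
      exact ⟨t, ht, hsub (Ioo_subset_Icc_self ht), ht0⟩
  choose! f hf hf' using key
  rw [signChangeCount, ← Set.ncard_coe_finset]
  refine Set.ncard_le_ncard_of_injOn f (fun k hk => hf' k hk) (fun k hk l hl hkl => ?_) hfin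
  rw [← floor_eq_of_mem_cell hh (hf k hk), hkl, floor_eq_of_mem_cell hh (hf l hl)]

lemma eventually_ncard_le_signChangeCount (hT : 0 < T)
    (hz : ∀ s ∈ Icc 0 T, HasDerivWithinAt z (z' s) (Icc 0 T) s)
    (hsimple : ∀ s ∈ Icc 0 T, z s = 0 → z' s ≠ 0)
    (hgrid : ∀ n k : ℕ, k ≤ n + 1 → z ((k : ℝ) * (T / (n + 1))) ≠ 0) :
    ∀ᶠ n in atTop, {t | t ∈ Icc 0 T ∧ z t = 0}.ncard ≤ signChangeCount T z n := by
  set S := {t | t ∈ Icc 0 T ∧ z t = 0} with hS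
  have hfin : S.Finite := finite_zeros_of_deriv_ne_zero hz hsimple
  have hSlt : ∀ t ∈ S, t ∈ Ico 0 T := by
    intro t ht
    refine ⟨ht.1.1, lt_of_le_of_ne ht.1.2 ?_⟩
    rintro rfl
    have := hgrid 0 1 (by norm_num)
    simp only [Nat.cast_one, Nat.cast_zero, zero_add, div_one, one_mul] at this
    exact this ht.2
  have hmesh := tendsto_mesh T
  have hinj : ∀ᶠ n : ℕ in atTop, ∀ t ∈ S, ∀ s ∈ S,
      ⌊t / (T / ((n : ℝ) + 1))⌋₊ = ⌊s / (T / ((n : ℝ) + 1))⌋₊ → t = s := by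
    rw [eventually_all_finite hfin]
    intro t ht
    rw [eventually_all_finite hfin]
    intro s hs
    by_cases hts : t = s
    · exact Eventually.of_forall fun _ _ => hts
    · filter_upwards [hmesh.eventually_lt_const (abs_pos.2 (sub_ne_zero.2 hts))] with n hn heq
      exfalso
      obtain ⟨h1, h2, -⟩ := cell_mem hT (hSlt t ht) n
      obtain ⟨h3, h4, -⟩ := cell_mem hT (hSlt s hs) n
      rw [heq] at h1 h2
      rw [add_mul, one_mul] at h2 h4
      have : |t - s| < T / (n + 1) := abs_lt.2 ⟨by linarith, by linarith⟩
      linarith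
  have hsign : ∀ᶠ n : ℕ in atTop, ∀ t ∈ S,
      z ((⌊t / (T / ((n : ℝ) + 1))⌋₊ : ℝ) * (T / (n + 1))) *
        z (((⌊t / (T / ((n : ℝ) + 1))⌋₊ + 1 : ℕ) : ℝ) * (T / (n + 1))) < 0 := by
    rw [eventually_all_finite hfin]
    intro t ht
    have hslope := hasDerivWithinAt_iff_tendsto_slope.1 (hz t ht.1)
    have hpos : 0 < z' t * z' t := mul_self_pos.2 (hsimple t ht.1 ht.2)
    have hev := (hslope.const_mul (z' t)).eventually_const_lt hpos
    obtain ⟨δ, hδ, hball⟩ := Metric.eventually_nhds_iff.1 (eventually_nhdsWithin_iff.1 hev)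
    filter_upwards [hmesh.eventually_lt_const hδ] with n hn
    obtain ⟨h1, h2, h3⟩ := cell_mem hT (hSlt t ht) n
    set k := ⌊t / (T / ((n : ℝ) + 1))⌋₊
    have hk := grid_mem_Icc hT (n := n) (k := k) (by omega)
    have hk' := grid_mem_Icc hT (n := n) (k := k + 1) (by omega)
    have hzk := hgrid n k (by omega)
    have hcast : ((k + 1 : ℕ) : ℝ) * (T / (n + 1)) = k * (T / (n + 1)) + T / (n + 1) := by
      push_cast; ring
    rw [add_mul, one_mul] at h2
    rw [hcast] at hk' ⊢
    set s := (k : ℝ) * (T / (n + 1))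
    have hst : s < t := lt_of_le_of_ne h1 fun h => hzk (h ▸ ht.2)
    have e1 := hball (y := s) (by rw [Real.dist_eq, abs_lt]; constructor <;> linarith)
      ⟨hk, hst.ne⟩
    have e2 := hball (y := s + T / (n + 1)) (by rw [Real.dist_eq, abs_lt]; constructor <;> linarith)
      ⟨hk', h2.ne'⟩
    rw [slope_def_field, ht.2, sub_zero] at e1 e2
    have e3 : 0 < (z' t * z' t) * (z s * z (s + T / (n + 1))) /
        ((s - t) * (s + T / (n + 1) - t)) := by
      have := mul_pos e1 e2
      rwa [← mul_div_assoc, ← mul_div_assoc, div_mul_div_comm, mul_mul_mul_comm] at this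
    have hden : (s - t) * (s + T / (n + 1) - t) < 0 :=
      mul_neg_of_neg_of_pos (by linarith) (by linarith)
    have e4 : (z' t * z' t) * (z s * z (s + T / (n + 1))) < 0 := by
      by_contra hcon
      exact absurd e3 (not_lt.2 (div_nonpos_of_nonneg_of_nonpos (not_lt.1 hcon) hden.le))
    exact (pos_iff_neg_of_mul_neg e4).1 hpos
  filter_upwards [hinj, hsign] with n h1 h2
  rw [signChangeCount, ← Set.ncard_coe_finset]
  refine Set.ncard_le_ncard_of_injOn (fun t => ⌊t / (T / ((n : ℝ) + 1))⌋₊) (fun t ht => ?_)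
    (fun t ht s hs hts => h1 t ht s hs hts) (Finset.finite_toSet _)
  rw [Finset.mem_coe, Finset.mem_filter, Finset.mem_range]
  exact ⟨(cell_mem hT (hSlt t ht) n).2.2, h2 t ht⟩

lemma eventually_signChangeCount_eq (hT : 0 < T)
    (hz : ∀ s ∈ Icc 0 T, HasDerivWithinAt z (z' s) (Icc 0 T) s)
    (hsimple : ∀ s ∈ Icc 0 T, z s = 0 → z' s ≠ 0)
    (hgrid : ∀ n k : ℕ, k ≤ n + 1 → z ((k : ℝ) * (T / (n + 1))) ≠ 0) :
    ∀ᶠ n in atTop, signChangeCount T z n = {t | t ∈ Icc 0 T ∧ z t = 0}.ncard := by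
  filter_upwards [eventually_ncard_le_signChangeCount hT hz hsimple hgrid] with n hn
  exact le_antisymm (signChangeCount_le_ncard hT (fun s hs => (hz s hs).continuousWithinAt)
    (finite_zeros_of_deriv_ne_zero hz hsimple) n) hn

end Crossings

lemma signChangeCount_eq_sum {Ω : Type*} {T : ℝ} {Z : ℝ → Ω → ℝ} (ω : Ω)
    (n : ℕ) :
    (signChangeCount T (fun t => Z t ω) n : ℝ) = ∑ k ∈ Finset.range (n + 1),
      {ω | Z ((k : ℝ) * (T / (n + 1))) ω * Z (((k + 1 : ℕ) : ℝ) * (T / (n + 1))) ω < 0}.indicator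
        1 ω := by
  rw [signChangeCount, Finset.card_filter]
  push_cast
  refine Finset.sum_congr rfl fun k _ => ?_
  simp [indicator_apply]

section Expectation

variable {Ω : Type*} [MeasurableSpace Ω] {P : Measure Ω} [IsProbabilityMeasure P] {T : ℝ}
  {Z Z' : ℝ → Ω → ℝ}

lemma measurableSet_signChange (hZ : ∀ t, Measurable (Z t)) (s u : ℝ) :
    MeasurableSet {ω | Z s ω * Z u ω < 0} :=
  measurableSet_lt ((hZ s).mul (hZ u)) measurable_const

lemma integral_signChangeCount (hZ : ∀ t, Measurable (Z t)) (n : ℕ) :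
    ∫ ω, (signChangeCount T (fun t => Z t ω) n : ℝ) ∂P = ∑ k ∈ Finset.range (n + 1),
      P.real {ω | Z ((k : ℝ) * (T / (n + 1))) ω * Z (((k + 1 : ℕ) : ℝ) * (T / (n + 1))) ω < 0} := by
  simp_rw [signChangeCount_eq_sum]
  rw [MeasureTheory.integral_finsetSum]
  · refine Finset.sum_congr rfl fun k _ => ?_
    rw [integral_indicator_one (measurableSet_signChange hZ _ _)]
  · exact fun k _ => (integrable_const (1 : ℝ)).indicator (measurableSet_signChange hZ _ _)

lemma measurable_signChangeCount (hZ : ∀ t, Measurable (Z t)) (n : ℕ) :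
    Measurable fun ω => (signChangeCount T (fun t => Z t ω) n : ℝ) := by
  simp_rw [signChangeCount_eq_sum]
  exact Finset.measurable_sum _ fun k _ =>
    measurable_one.indicator (measurableSet_signChange hZ _ _)

/-- The expected number of zeros is the limit of the expected numbers of sign changes. -/
lemma integral_ncard_zeros_eq_of_tendsto (hT : 0 < T) (hZ : ∀ t, Measurable (Z t))
    (hpath : ∀ᵐ ω ∂P, ∀ s ∈ Icc 0 T, HasDerivWithinAt (fun t => Z t ω) (Z' s ω) (Icc 0 T) s)
    (hsimple : ∀ᵐ ω ∂P, ∀ s ∈ Icc 0 T, Z s ω = 0 → Z' s ω ≠ 0)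
    (hgrid : ∀ᵐ ω ∂P, ∀ n k : ℕ, k ≤ n + 1 → Z ((k : ℝ) * (T / (n + 1))) ω ≠ 0) {L : ℝ}
    (hL : Tendsto (fun n : ℕ => ∑ k ∈ Finset.range (n + 1),
      P.real {ω | Z ((k : ℝ) * (T / (n + 1))) ω * Z (((k + 1 : ℕ) : ℝ) * (T / (n + 1))) ω < 0})
      atTop (𝓝 L)) :
    ∫ ω, ({t | t ∈ Icc 0 T ∧ Z t ω = 0}.ncard : ℝ) ∂P = L := by
  simp_rw [← integral_signChangeCount hZ] at hL
  have hlim : ∀ᵐ ω ∂P, Tendsto (fun n => (signChangeCount T (fun t => Z t ω) n : ℝ)) atTop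
      (𝓝 ({t | t ∈ Icc 0 T ∧ Z t ω = 0}.ncard : ℝ)) := by
    filter_upwards [hpath, hsimple, hgrid] with ω h1 h2 h3
    refine tendsto_const_nhds.congr' ?_
    filter_upwards [eventually_signChangeCount_eq hT h1 h2 h3] with n hn
    rw [hn]
  have hle : ∀ᵐ ω ∂P, ∀ n, signChangeCount T (fun t => Z t ω) n ≤
      {t | t ∈ Icc 0 T ∧ Z t ω = 0}.ncard := by
    filter_upwards [hpath, hsimple] with ω h1 h2 n
    exact signChangeCount_le_ncard hT (fun s hs => (h1 s hs).continuousWithinAt)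
      (finite_zeros_of_deriv_ne_zero h1 h2) n
  have hCint : ∀ n, Integrable (fun ω => (signChangeCount T (fun t => Z t ω) n : ℝ)) P := by
    intro n
    simp_rw [signChangeCount_eq_sum]
    exact integrable_finsetSum _ fun k _ =>
      (integrable_const (1 : ℝ)).indicator (measurableSet_signChange hZ _ _)
  have hNm : AEStronglyMeasurable (fun ω => ({t | t ∈ Icc 0 T ∧ Z t ω = 0}.ncard : ℝ)) P :=
    aestronglyMeasurable_of_tendsto_ae atTop
      (fun n => (measurable_signChangeCount hZ n).aestronglyMeasurable) hlim
  have hfatou : ∫⁻ ω, ENNReal.ofReal ({t | t ∈ Icc 0 T ∧ Z t ω = 0}.ncard : ℝ) ∂P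
      ≤ ENNReal.ofReal L := by
    calc _ = ∫⁻ ω, liminf (fun n => ENNReal.ofReal
            (signChangeCount T (fun t => Z t ω) n : ℝ)) atTop ∂P := by
          refine lintegral_congr_ae ?_
          filter_upwards [hlim] with ω hω
          exact ((ENNReal.continuous_ofReal.tendsto _).comp hω).liminf_eq.symm
      _ ≤ liminf (fun n => ∫⁻ ω, ENNReal.ofReal
            (signChangeCount T (fun t => Z t ω) n : ℝ) ∂P) atTop :=
          lintegral_liminf_le fun n => (measurable_signChangeCount hZ n).ennreal_ofReal
      _ = ENNReal.ofReal L := by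
          refine Tendsto.liminf_eq ?_
          refine ((ENNReal.continuous_ofReal.tendsto _).comp hL).congr fun n => ?_
          exact ofReal_integral_eq_lintegral_ofReal (hCint n)
            (Eventually.of_forall fun _ => Nat.cast_nonneg _)
  have hNint : Integrable (fun ω => ({t | t ∈ Icc 0 T ∧ Z t ω = 0}.ncard : ℝ)) P := by
    refine ⟨hNm, ?_⟩
    rw [hasFiniteIntegral_iff_ofReal (Eventually.of_forall fun _ => Nat.cast_nonneg _)]
    exact hfatou.trans_lt ENNReal.ofReal_lt_top
  refine tendsto_nhds_unique (tendsto_integral_of_dominated_convergence _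
    (fun n => (measurable_signChangeCount hZ n).aestronglyMeasurable) hNint (fun n => ?_) hlim) hL
  filter_upwards [hle] with ω hω
  rw [Real.norm_of_nonneg (Nat.cast_nonneg _)]
  exact_mod_cast hω n

end Expectation

lemma gaussianReal_Icc_le {a b : ℝ} (hab : a ≤ b) :
    gaussianReal 0 1 (Icc a b) ≤ ENNReal.ofReal (b - a) := by
  have := nullSingletonClass_gaussianReal (μ := 0) (v := 1) one_ne_zero
  rw [← measure_congr (Ioo_ae_eq_Icc (μ := gaussianReal 0 1) (a := a) (b := b))]
  have h := gaussianReal_uIoo a b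
  rw [min_eq_left hab, max_eq_right hab] at h
  rw [h]
  refine ENNReal.ofReal_le_ofReal ((abs_Phi_sub_le a b).trans ?_)
  rw [abs_of_nonneg (sub_nonneg.2 hab)]

lemma exists_grid_near {T : ℝ} (hT : 0 < T) {t : ℝ} (ht : t ∈ Icc 0 T) (n : ℕ) :
    ∃ k : ℕ, k ≤ n + 1 ∧ |t - k * (T / (n + 1))| ≤ T / (n + 1) := by
  have hh : 0 < T / ((n : ℝ) + 1) := by positivity
  rcases ht.2.eq_or_lt with h | h
  · refine ⟨n + 1, le_rfl, ?_⟩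
    push_cast
    rw [mul_div_cancel₀ _ (by positivity), h, sub_self, abs_zero]
    exact hh.le
  · obtain ⟨h1, h2, h3⟩ := cell_mem hT ⟨ht.1, h⟩ n
    refine ⟨_, h3.le, ?_⟩
    rw [add_mul, one_mul] at h2
    rw [abs_of_nonneg (by linarith)]
    linarith

/-- Bulinskaya's lemma: a process with `C¹` paths and uniformly bounded small-ball probabilities
almost surely has no tangential zeros. -/
lemma ae_forall_zero_deriv_ne_zero {Ω : Type*} [MeasurableSpace Ω] {P : Measure Ω} {T : ℝ}
    (hT : 0 < T) {Z Z' : ℝ → Ω → ℝ}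
    (hpath : ∀ᵐ ω ∂P, (∀ s ∈ Icc 0 T, HasDerivWithinAt (fun t => Z t ω) (Z' s ω) (Icc 0 T) s) ∧
      ContinuousOn (fun t => Z' t ω) (Icc 0 T))
    {C : ℝ} (hC : 0 ≤ C)
    (hball : ∀ t ∈ Icc 0 T, ∀ a, 0 ≤ a → P {ω | |Z t ω| ≤ a} ≤ ENNReal.ofReal (C * a)) :
    ∀ᵐ ω ∂P, ∀ s ∈ Icc 0 T, Z s ω = 0 → Z' s ω ≠ 0 := by
  set Tan : Set Ω := {ω | ∃ s ∈ Icc 0 T, Z s ω = 0 ∧ Z' s ω = 0} with hTan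
  set Good : Set Ω := {ω |
    (∀ s ∈ Icc 0 T, HasDerivWithinAt (fun t => Z t ω) (Z' s ω) (Icc 0 T) s) ∧
      ContinuousOn (fun t => Z' t ω) (Icc 0 T)} with hGood
  have hbound : ∀ ε > 0, P Tan ≤ ENNReal.ofReal (2 * T * C * ε) := by
    intro ε hε
    set B : ℕ → Set Ω := fun n => {ω | ω ∈ Tan ∧ ω ∈ Good ∧ ∀ s ∈ Icc 0 T, ∀ t ∈ Icc 0 T,
      |s - t| ≤ T / (n + 1) → |Z' s ω - Z' t ω| ≤ ε} with hB
    have hmono : Monotone B := by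
      intro n l hnl ω hω
      refine ⟨hω.1, hω.2.1, fun s hs t ht hst => hω.2.2 s hs t ht (hst.trans ?_)⟩
      gcongr
    have hunion : Tan ∩ Good ⊆ ⋃ n, B n := by
      rintro ω ⟨h1, h2⟩
      have huc := isCompact_Icc.uniformContinuousOn_of_continuous h2.2
      obtain ⟨δ, hδ, h⟩ := Metric.uniformContinuousOn_iff.1 huc ε hε
      obtain ⟨n, hn⟩ := ((tendsto_mesh T).eventually_lt_const hδ).exists
      refine mem_iUnion.2 ⟨n, h1, h2, fun s hs t ht hst => ?_⟩
      exact (h s hs t ht (by rw [Real.dist_eq]; linarith)).le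
    have hBle : ∀ n, P (B n) ≤ ENNReal.ofReal (2 * T * C * ε) := by
      intro n
      have hh : 0 < T / ((n : ℝ) + 1) := by positivity
      have hsub : B n ⊆ ⋃ k ∈ Finset.range (n + 2),
          {ω | |Z ((k : ℝ) * (T / (n + 1))) ω| ≤ T / (n + 1) * ε} := by
        rintro ω ⟨⟨s, hs, h0, h0'⟩, hg, hω⟩
        obtain ⟨k, hk, hks⟩ := exists_grid_near hT hs n
        have hkI := grid_mem_Icc hT hk
        obtain ⟨c, hc, hcs⟩ := exists_sub_eq_mul_deriv hg.1 hs hkI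
        simp only [h0, sub_zero] at hcs
        have hcI : c ∈ Icc 0 T := uIcc_subset_Icc hs hkI hc
        have hcd : |c - s| ≤ T / (n + 1) := by
          refine (abs_sub_left_of_mem_uIcc hc).trans ?_
          rwa [abs_sub_comm]
        have hz := hω c hcI s hs hcd
        rw [h0', sub_zero] at hz
        simp only [mem_iUnion, Finset.mem_range]
        refine ⟨k, by omega, ?_⟩
        rw [mem_ofPred_eq, hcs, abs_mul, abs_sub_comm]
        gcongr
      calc P (B n) ≤ _ := measure_mono hsub
        _ ≤ ∑ k ∈ Finset.range (n + 2), P {ω | |Z ((k : ℝ) * (T / (n + 1))) ω| ≤ T / (n + 1) * ε} :=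
          measure_biUnion_finset_le _ _
        _ ≤ ∑ k ∈ Finset.range (n + 2), ENNReal.ofReal (C * (T / (n + 1) * ε)) := by
          refine Finset.sum_le_sum fun k hk => ?_
          exact hball _ (grid_mem_Icc hT (by have := Finset.mem_range.1 hk; omega)) _
            (by positivity)
        _ = ENNReal.ofReal ((n + 2) * (C * (T / (n + 1) * ε))) := by
          rw [Finset.sum_const, Finset.card_range, nsmul_eq_mul, 
            ENNReal.ofReal_mul (p := (n : ℝ) + 2) (by positivity)]
          congr 1
          rw [← ENNReal.ofReal_natCast]
          push_cast
          rfl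
        _ ≤ _ := by
          refine ENNReal.ofReal_le_ofReal ?_
          have h2 : ((n : ℝ) + 2) / (n + 1) ≤ 2 := by
            rw [div_le_iff₀ (by positivity)]
            have : (0 : ℝ) ≤ n := n.cast_nonneg
            linarith
          calc _ = ((n : ℝ) + 2) / (n + 1) * (T * C * ε) := by field_simp
            _ ≤ 2 * (T * C * ε) := by gcongr
            _ = _ := by ring
    have hGoodc : P Goodᶜ = 0 := hpath
    calc P Tan ≤ P ((Tan ∩ Good) ∪ Goodᶜ) := measure_mono fun ω hω => by
          by_cases h : ω ∈ Good
          · exact Or.inl ⟨hω, h⟩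
          · exact Or.inr h
      _ ≤ P (Tan ∩ Good) + P Goodᶜ := measure_union_le _ _
      _ ≤ P (⋃ n, B n) := by rw [hGoodc, add_zero]; exact measure_mono hunion
      _ = ⨆ n, P (B n) := hmono.measure_iUnion
      _ ≤ _ := iSup_le hBle
  have hlim : Tendsto (fun ε : ℝ => ENNReal.ofReal (2 * T * C * ε)) (𝓝[>] 0) (𝓝 0) := by
    have : Tendsto (fun ε : ℝ => ENNReal.ofReal (2 * T * C * ε)) (𝓝 0) (𝓝 (ENNReal.ofReal 0)) :=
      (ENNReal.continuous_ofReal.tendsto 0).comp (by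
        simpa using (tendsto_id (α := ℝ) (x := 𝓝 0)).const_mul (2 * T * C))
    rw [ENNReal.ofReal_zero] at this
    exact this.mono_left nhdsWithin_le_nhds
  have h0 : P Tan = 0 := le_antisymm
    (ge_of_tendsto hlim (by filter_upwards [self_mem_nhdsWithin] with ε hε using hbound ε hε))
    bot_le
  rw [ae_iff]
  refine measure_mono_null (fun ω hω => ?_) h0
  simp only [mem_ofPred_eq, not_forall, not_not] at hω
  obtain ⟨s, hs, h1, h2⟩ := hω
  exact ⟨s, hs, h1, h2⟩

section MeanSquare

open scoped RealInnerProductSpace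

variable {Ω : Type*} [MeasurableSpace Ω] {P : Measure Ω}

lemma hasGaussianLaw_pair {I : Set ℝ} {Z : ℝ → Ω → ℝ} (hZ : ∀ t, Measurable (Z t))
    (hGauss : ∀ (n : ℕ) (ts : Fin n → ℝ), (∀ i, ts i ∈ I) →
      ∀ (c : Fin n → ℝ), ∃ (μ₀ : ℝ) (v : NNReal),
        Measure.map (fun ω => ∑ i, c i * Z (ts i) ω) P = gaussianReal μ₀ v)
    {s u : ℝ} (hs : s ∈ I) (hu : u ∈ I) : HasGaussianLaw (fun ω => (Z s ω, Z u ω)) P where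
  isGaussian_map := by
    refine isGaussian_of_map_eq_gaussianReal fun L => ?_
    obtain ⟨a, v, h⟩ := hGauss 2 ![s, u] (by simp [Fin.forall_fin_two, hs, hu])
      ![L (1, 0), L (0, 1)]
    refine ⟨a, v, ?_⟩
    rw [Measure.map_map (by fun_prop) ((hZ s).prodMk (hZ u)), ← h]
    congr 1
    ext ω
    have : (Z s ω, Z u ω) = Z s ω • ((1, 0) : ℝ × ℝ) + Z u ω • ((0, 1) : ℝ × ℝ) := by simp
    simp only [Function.comp_apply]
    rw [this, map_add, map_smul, map_smul]
    simp [Fin.sum_univ_two, mul_comm]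

lemma exists_L2_curve {I : Set ℝ} {f : ℝ → Ω → ℝ} (hf : ∀ t ∈ I, MemLp (f t) 2 P) :
    ∃ Y : ℝ → Lp ℝ 2 P, ∀ t ∈ I, Y t =ᵐ[P] f t := by
  classical
  refine ⟨fun t => if h : MemLp (f t) 2 P then h.toLp _ else 0, fun t ht => ?_⟩
  simp only [hf t ht, dite_true]
  exact (hf t ht).coeFn_toLp

lemma inner_eq_integral_of_ae_eq {f g : Lp ℝ 2 P} {F G : Ω → ℝ} (hf : f =ᵐ[P] F) (hg : g =ᵐ[P] G) :
    ⟪f, g⟫ = ∫ ω, F ω * G ω ∂P := by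
  rw [L2.inner_def]
  refine integral_congr_ae ?_
  filter_upwards [hf, hg] with ω h1 h2
  rw [h1, h2]
  simp [mul_comm]

/-- The mean-square derivative agrees almost surely with the pathwise derivative. -/
lemma ae_eq_of_hasDerivWithinAt_Lp {T : ℝ} (hT : 0 < T) {f : ℝ → Ω → ℝ} {f' : Ω → ℝ}
    {Y : ℝ → Lp ℝ 2 P} {V : Lp ℝ 2 P} {t : ℝ} (ht : t ∈ Icc 0 T)
    (hY : ∀ s ∈ Icc 0 T, Y s =ᵐ[P] f s) (hV : HasDerivWithinAt Y V (Icc 0 T) t)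
    (hf : ∀ᵐ ω ∂P, HasDerivWithinAt (fun s => f s ω) (f' ω) (Icc 0 T) t) : V =ᵐ[P] f' := by
  have := neBot_nhdsWithin_Icc_diff_singleton hT ht
  obtain ⟨u, hu⟩ := exists_seq_tendsto (𝓝[Icc 0 T \ {t}] t)
  have huI : ∀ᶠ n in atTop, u n ∈ Icc 0 T \ {t} := hu.eventually self_mem_nhdsWithin
  have h1 := (hasDerivWithinAt_iff_tendsto_slope.1 hV).comp hu
  obtain ⟨ns, hns, hae⟩ := (tendstoInMeasure_of_tendsto_Lp h1).exists_seq_tendsto_ae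
  have hslope : ∀ᵐ ω ∂P, ∀ n, u n ∈ Icc 0 T \ {t} →
      (slope Y t (u n) : Lp ℝ 2 P) ω = slope (fun s => f s ω) t (u n) := by
    rw [ae_all_iff]
    intro n
    by_cases hn : u n ∈ Icc 0 T \ {t}
    · have e1 := Lp.coeFn_smul (u n - t)⁻¹ (Y (u n) - Y t)
      have e2 := Lp.coeFn_sub (Y (u n)) (Y t)
      filter_upwards [e1, e2, hY _ hn.1, hY t ht] with ω h1 h2 h3 h4 _
      rw [slope, vsub_eq_sub, h1, Pi.smul_apply, h2, Pi.sub_apply, h3, h4]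
      rfl
    · exact Eventually.of_forall fun ω h => absurd h hn
  filter_upwards [hae, hslope, hf] with ω h2 h3 h4
  have h5 := ((hasDerivWithinAt_iff_tendsto_slope.1 h4).comp hu).comp hns.tendsto_atTop
  refine tendsto_nhds_unique h2 (h5.congr' ?_)
  filter_upwards [hns.tendsto_atTop.eventually huI] with n hn
  exact (h3 _ hn).symm

lemma integral_eq_zero_of_hasDerivWithinAt_Lp [IsProbabilityMeasure P] {T : ℝ} (hT : 0 < T)
    {Y : ℝ → Lp ℝ 2 P} {V : Lp ℝ 2 P} {t : ℝ} (ht : t ∈ Icc 0 T)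
    (hY : ∀ s ∈ Icc 0 T, ∫ ω, Y s ω ∂P = 0) (hV : HasDerivWithinAt Y V (Icc 0 T) t) :
    ∫ ω, V ω ∂P = 0 := by
  have hone : MemLp (fun _ : Ω => (1 : ℝ)) 2 P := memLp_const 1
  have hInt : ∀ g : Lp ℝ 2 P, ⟪hone.toLp _, g⟫ = ∫ ω, g ω ∂P := by
    intro g
    rw [inner_eq_integral_of_ae_eq hone.coeFn_toLp (ae_eq_refl _)]
    simp
  rw [← hInt]
  have h1 := (hasDerivWithinAt_const t (Icc 0 T) (hone.toLp _)).inner ℝ hV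
  rw [inner_zero_left, add_zero] at h1
  have h2 : HasDerivWithinAt (fun s => ⟪hone.toLp _, Y s⟫) 0 (Icc 0 T) t :=
    (hasDerivWithinAt_const t (Icc 0 T) (0 : ℝ)).congr (fun s hs => by rw [hInt, hY s hs])
      (by rw [hInt, hY t ht])
  exact (uniqueDiffOn_Icc hT t ht).eq_deriv _ h1 h2

end MeanSquare

section Normalized

open scoped RealInnerProductSpace

variable {H : Type*} [NormedAddCommGroup H] [InnerProductSpace ℝ H]

/-- Derivative of the normalized curve and of the normalized mean, in terms of the standard
deviation `ξ` of the derivative and its correlation `μ` with the process. -/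
lemma exists_normalized_deriv {T : ℝ} (hT : 0 < T) {Y : ℝ → H} {V : H} {t : ℝ} (ht : t ∈ Icc 0 T)
    (hV : HasDerivWithinAt Y V (Icc 0 T) t) {σ m M : ℝ → ℝ} {m' M' ξ μ : ℝ}
    (hσ : ∀ s ∈ Icc 0 T, σ s = ‖Y s‖) (hσpos : 0 < σ t)
    (hm : HasDerivWithinAt m m' (Icc 0 T) t) (hM : ∀ s, M s = m s / σ s)
    (hM' : HasDerivWithinAt M M' (Icc 0 T) t)
    (hξ : ξ = ‖V‖) (hμ : μ = ⟪Y t, V⟫ / (σ t * ξ)) :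
    ∃ v : H, HasDerivWithinAt (fun s => ‖Y s‖⁻¹ • Y s) v (Icc 0 T) t ∧
      ‖v‖ = ξ * √(1 - μ ^ 2) / σ t ∧ ‖v‖ ^ 2 ≤ ‖V‖ ^ 2 / σ t ^ 2 ∧
      (m' - ξ * μ * m t / σ t) / (ξ * √(1 - μ ^ 2)) = M' / ‖v‖ := by
  have hσt := hσ t ht
  have h0 : Y t ≠ 0 := by rw [← norm_pos_iff, ← hσt]; exact hσpos
  obtain ⟨v, hv, hvn, hnorm⟩ := hasDerivWithinAt_normalize hV h0
  have hξμ : ⟪Y t, V⟫ / ‖Y t‖ = ξ * μ := by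
    rw [hμ, ← hσt]
    rcases eq_or_ne ξ 0 with h | h
    · have : V = 0 := norm_eq_zero.1 (hξ ▸ h)
      simp [this]
    · field_simp
  rw [hξμ, ← hξ, ← hσt] at hvn
  rw [hξμ] at hnorm
  have hvn' : ‖v‖ = ξ * √(1 - μ ^ 2) / σ t := by
    have hξ0 : 0 ≤ ξ := hξ ▸ norm_nonneg V
    have h1 : ‖v‖ ^ 2 = ξ ^ 2 * (1 - μ ^ 2) / σ t ^ 2 := by rw [hvn]; ring
    rcases eq_or_lt_of_le hξ0 with h | h
    · rw [← h] at h1 ⊢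
      simpa using h1
    · have h2 : 0 ≤ 1 - μ ^ 2 := by
        have h3 : 1 - μ ^ 2 = ‖v‖ ^ 2 * σ t ^ 2 / ξ ^ 2 := by rw [h1]; field_simp
        rw [h3]; positivity
      rw [← sq_eq_sq₀ (norm_nonneg _) (by positivity), h1, div_pow, mul_pow, Real.sq_sqrt h2]
  refine ⟨v, hv, hvn', ?_, ?_⟩
  · rw [hvn, ← hξ]
    gcongr
    nlinarith [sq_nonneg (ξ * μ)]
  · have hσ' : HasDerivWithinAt σ (ξ * μ) (Icc 0 T) t := hnorm.congr hσ hσt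
    have h1 : HasDerivWithinAt M ((m' * σ t - m t * (ξ * μ)) / σ t ^ 2) (Icc 0 T) t := by
      have : M = fun s => m s / σ s := funext hM
      rw [this]
      exact hm.fun_div hσ' hσpos.ne'
    rw [(uniqueDiffOn_Icc hT t ht).eq_deriv _ hM' h1, hvn']
    rcases eq_or_ne (ξ * √(1 - μ ^ 2)) 0 with h | h
    · simp [h]
    · rw [div_div_eq_mul_div]
      congr 1
      field_simp

lemma exists_lipschitz_bound {E : Type*} [NormedAddCommGroup E] [NormedSpace ℝ E] {T : ℝ}
    {f f' : ℝ → E} (hf : ∀ t ∈ Icc 0 T, HasDerivWithinAt f (f' t) (Icc 0 T) t) {C : ℝ}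
    (hC : ∀ t ∈ Icc 0 T, ‖f' t‖ ≤ C) :
    ∀ s ∈ Icc 0 T, ∀ u ∈ Icc 0 T, ‖f u - f s‖ ≤ C * |u - s| := fun _ hs _ hu =>
  Convex.norm_image_sub_le_of_norm_hasDerivWithin_le hf hC (convex_Icc 0 T) hs hu

lemma integral_crossKernel_le {y z : H} (hy : ‖y‖ = 1) (hz : ‖z‖ = 1) {K h a b : ℝ}
    (hyz : ‖z - y‖ ≤ K * h) (hab : |b - a| ≤ K * h) (ha : |a| ≤ K) (hKh : K * h ≤ 1) :
    |∫ x, crossKernel a b ⟪y, z⟫ x ∂(gaussianReal 0 1)| ≤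
      (2 * K * (1 + K) * ∫ x, (1 + |x|) ∂(gaussianReal 0 1)) * h := by
  have hnn : ∀ x, 0 ≤ crossKernel a b ⟪y, z⟫ x := fun x => abs_nonneg _
  have hInt : Integrable (fun x : ℝ => 1 + |x|) (gaussianReal 0 1) :=
    (integrable_const 1).add integrable_id_gaussianReal.abs
  rw [abs_of_nonneg (integral_nonneg hnn), ← MeasureTheory.integral_const_mul,
    ← MeasureTheory.integral_mul_const]
  exact integral_mono_of_nonneg (Eventually.of_forall hnn) ((hInt.const_mul _).mul_const _)
    (Eventually.of_forall fun x => crossKernel_le hy hz hyz hab ha hKh x)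

/-- Sums of sign-change probabilities over fine grids converge to the crossing intensity
integral. -/
lemma tendsto_sum_integral_crossKernel {T : ℝ} (hT : 0 < T) {y v : ℝ → H} {M M' : ℝ → ℝ} {K : ℝ}
    (hyn : ∀ s ∈ Icc 0 T, ‖y s‖ = 1)
    (hy : ∀ t ∈ Icc 0 T, HasDerivWithinAt y (v t) (Icc 0 T) t)
    (hM : ∀ t ∈ Icc 0 T, HasDerivWithinAt M (M' t) (Icc 0 T) t)
    (hvK : ∀ t ∈ Icc 0 T, ‖v t‖ ≤ K) (hM'K : ∀ t ∈ Icc 0 T, |M' t| ≤ K)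
    (hMK : ∀ t ∈ Icc 0 T, |M t| ≤ K) :
    IntervalIntegrable
        (fun t => phi (M t) * ∫ x, |M' t + ‖v t‖ * x| ∂(gaussianReal 0 1)) volume 0 T ∧
      Tendsto (fun n : ℕ => ∑ k ∈ Finset.range (n + 1),
        ∫ x, crossKernel (M ((k : ℝ) * (T / (n + 1)))) (M (((k + 1 : ℕ) : ℝ) * (T / (n + 1))))
          ⟪y ((k : ℝ) * (T / (n + 1))), y (((k + 1 : ℕ) : ℝ) * (T / (n + 1)))⟫ x
            ∂(gaussianReal 0 1)) atTop
        (𝓝 (∫ t in (0 : ℝ)..T, phi (M t) * ∫ x, |M' t + ‖v t‖ * x| ∂(gaussianReal 0 1))) := by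
  have hK : ∀ s ∈ Icc 0 T, ∀ u ∈ Icc 0 T, ‖y u - y s‖ ≤ K * |u - s| ∧ |M u - M s| ≤ K * |u - s| :=
    fun s hs u hu => ⟨exists_lipschitz_bound hy hvK s hs u hu,
      exists_lipschitz_bound hM hM'K s hs u hu⟩
  have hsub : ∀ n k : ℕ, ((k + 1 : ℕ) : ℝ) * (T / (n + 1)) - k * (T / (n + 1)) = T / (n + 1) := by
    intro n k
    push_cast
    ring
  refine tendsto_sum_range_of_tendsto_cell hT
    (C := 2 * K * (1 + K) * ∫ x, (1 + |x|) ∂(gaussianReal 0 1)) (p := fun n k =>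
      ∫ x, crossKernel (M ((k : ℝ) * (T / (n + 1)))) (M (((k + 1 : ℕ) : ℝ) * (T / (n + 1))))
        ⟪y ((k : ℝ) * (T / (n + 1))), y (((k + 1 : ℕ) : ℝ) * (T / (n + 1)))⟫ x
          ∂(gaussianReal 0 1)) ?_ ?_
  · have hlim : Tendsto (fun n : ℕ => K * (T / ((n : ℝ) + 1))) atTop (𝓝 0) := by
      simpa using (tendsto_mesh T).const_mul K
    filter_upwards [hlim.eventually_le_const one_pos] with n hn k hk
    have hh : 0 < T / ((n : ℝ) + 1) := by positivity
    have hs := grid_mem_Icc hT (n := n) (k := k) (by omega)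
    have hu := grid_mem_Icc hT (n := n) (k := k + 1) (by omega)
    have hKs := hK _ hs _ hu
    rw [hsub, abs_of_pos hh] at hKs
    exact integral_crossKernel_le (hyn _ hs) (hyn _ hu) hKs.1 hKs.2 (hMK _ hs) hn
  · intro t ht
    have htI := Ico_subset_Icc_self ht
    have hcell := cell_mem hT ht
    have := tendsto_inv_mul_integral_crossKernel hyn (hy t htI) (hM t htI) htI hK hMK
      (s := fun n : ℕ => (⌊t / (T / ((n : ℝ) + 1))⌋₊ : ℝ) * (T / (n + 1)))
      (u := fun n : ℕ => ((⌊t / (T / ((n : ℝ) + 1))⌋₊ + 1 : ℕ) : ℝ) * (T / (n + 1)))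
      (fun n => grid_mem_Icc hT (hcell n).2.2.le) (fun n => grid_mem_Icc hT (hcell n).2.2)
      (fun n => (hcell n).1) (fun n => by have := (hcell n).2.1.le; exact_mod_cast this)
      (fun n => by
        have hh : 0 < T / ((n : ℝ) + 1) := by positivity
        rw [← sub_pos, hsub]
        exact hh)
      (by simp_rw [hsub]; exact tendsto_mesh T)
    simp_rw [hsub] at this
    exact this

end Normalized

section GaussianPair

variable {Ω : Type*} [MeasurableSpace Ω] {P : Measure Ω}

lemma measureReal_mul_neg_of_hasGaussianLaw {X W : Ω → ℝ}
    (hXW : HasGaussianLaw (fun ω => (X ω, W ω)) P) {σ τ r : ℝ}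
    (hX : Measurable X) (hW : Measurable W) (hσ : 0 < σ) (hτ : 0 < τ)
    (hvX : Var[X; P] = σ ^ 2) (hvW : Var[W; P] = τ ^ 2) (hcov : cov[X, W; P] = σ * τ * r)
    (hr : 0 < r) (hr1 : r ≤ 1) :
    P.real {ω | X ω * W ω < 0} =
      ∫ x, crossKernel (P[X] / σ) (P[W] / τ) r x ∂(gaussianReal 0 1) := by
  have hAB : HasGaussianLaw (fun ω => (σ⁻¹ * X ω, τ⁻¹ * W ω)) P :=
    hXW.map_fun ((σ⁻¹ • ContinuousLinearMap.fst ℝ ℝ ℝ).prod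
      (τ⁻¹ • ContinuousLinearMap.snd ℝ ℝ ℝ))
  have h := measure_mul_neg_of_hasGaussianLaw hAB (hX.const_mul _) (hW.const_mul _)
    (MeasureTheory.integral_const_mul _ _) (MeasureTheory.integral_const_mul _ _)
    (by rw [variance_const_mul, hvX]; field_simp) (by rw [variance_const_mul, hvW]; field_simp)
    (r := r) (by rw [covariance_const_mul_left, covariance_const_mul_right, hcov]; field_simp)
    hr hr1
  have hset : {ω | X ω * W ω < 0} = {ω | σ⁻¹ * X ω * (τ⁻¹ * W ω) < 0} := by
    ext ω
    have : σ⁻¹ * X ω * (τ⁻¹ * W ω) = (σ⁻¹ * τ⁻¹) * (X ω * W ω) := by ring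
    simp only [mem_ofPred_eq]
    have h0 : 0 < σ⁻¹ * τ⁻¹ := by positivity
    rw [this]
    exact ⟨fun h => mul_neg_of_pos_of_neg h0 h, fun h => neg_of_mul_neg_right h h0.le⟩
  rw [hset, measureReal_def, h, integral_eq_lintegral_of_nonneg_ae (f := crossKernel _ _ _)
    (Eventually.of_forall fun x => (abs_nonneg _ : 0 ≤ crossKernel _ _ _ x))
    (continuous_crossKernel _ _ _).aestronglyMeasurable]
  simp only [crossKernel, div_eq_inv_mul]

lemma measure_abs_le_of_hasGaussianLaw {X : Ω → ℝ} (hX : HasGaussianLaw X P)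
    {σ c a : ℝ} (hv : Var[X; P] = σ ^ 2) (hc : 0 < c) (hcσ : c ≤ σ) (ha : 0 ≤ a) :
    P {ω | |X ω| ≤ a} ≤ ENNReal.ofReal (2 / c * a) := by
  have hσ := hc.trans_le hcσ
  have hmap : P.map X = (gaussianReal 0 1).map (fun x => P[X] + σ * x) := by
    rw [hX.map_eq_gaussianReal, hv]
    have : (fun x => P[X] + σ * x) = (P[X] + ·) ∘ (σ * ·) := rfl
    rw [this, ← Measure.map_map (by fun_prop) (by fun_prop), gaussianReal_map_const_mul,
      gaussianReal_map_const_add]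
    congr 1
    · simp
    · ext
      simp [Real.coe_toNNReal _ (sq_nonneg σ)]
  have hmeas : MeasurableSet {x : ℝ | |x| ≤ a} := measurableSet_le (by fun_prop) (by fun_prop)
  have h1 : P {ω | |X ω| ≤ a} = P.map X {x | |x| ≤ a} := by
    rw [Measure.map_apply_of_aemeasurable hX.aemeasurable hmeas]
    rfl
  rw [h1, hmap, Measure.map_apply (by fun_prop) hmeas]
  refine (measure_mono (t := Icc ((-a - P[X]) / σ) ((a - P[X]) / σ)) fun x hx => ?_).trans
    ((gaussianReal_Icc_le (by gcongr; linarith)).trans (ENNReal.ofReal_le_ofReal ?_))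
  · obtain ⟨h2, h3⟩ := abs_le.1 (show |P[X] + σ * x| ≤ a from hx)
    rw [mem_Icc, div_le_iff₀ hσ, le_div_iff₀ hσ]
    constructor <;> linarith
  · calc (a - P[X]) / σ - (-a - P[X]) / σ = 2 / σ * a := by ring
      _ ≤ 2 / c * a := by gcongr

end GaussianPair

section LeadbetterCryer

open scoped RealInnerProductSpace

variable {Ω : Type*} [MeasurableSpace Ω] {P : Measure Ω}

/-- The centred process as a mean-square differentiable curve in `L²`. -/
lemma exists_Lp_curve_of_hasGaussianLaw [IsProbabilityMeasure P] {T : ℝ} (hT : 0 < T)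
    {Z Z' : ℝ → Ω → ℝ}
    (hlaw : ∀ s ∈ Icc 0 T, HasGaussianLaw (Z s) P)
    (hpath : ∀ᵐ ω ∂P, ∀ s ∈ Icc 0 T, HasDerivWithinAt (fun t => Z t ω) (Z' s ω) (Icc 0 T) s)
    {m m' : ℝ → ℝ} {Γ Γ₁ Γ₁₁ : ℝ → ℝ → ℝ}
    (hm : ∀ s, m s = ∫ ω, Z s ω ∂P)
    (hm' : ∀ s ∈ Icc 0 T, HasDerivWithinAt m (m' s) (Icc 0 T) s)
    (hΓ : ∀ s t, Γ s t = ∫ ω, (Z s ω - m s) * (Z t ω - m t) ∂P)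
    (hΓ₁ : ∀ t ∈ Icc 0 T, ∀ s ∈ Icc (0 : ℝ) T,
      HasDerivWithinAt (fun u => Γ u t) (Γ₁ s t) (Icc 0 T) s)
    (hΓ₁₁ : ∀ s ∈ Icc 0 T, ∀ t ∈ Icc (0 : ℝ) T,
      HasDerivWithinAt (fun u => Γ₁ s u) (Γ₁₁ s t) (Icc 0 T) t)
    (hΓ₁₁cont : ∀ s ∈ Icc (0 : ℝ) T,
      ContinuousWithinAt (fun p : ℝ × ℝ => Γ₁₁ p.1 p.2) (Icc 0 T ×ˢ Icc 0 T) (s, s)) :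
    ∃ Y V : ℝ → Lp ℝ 2 P, (∀ s ∈ Icc 0 T, ∀ t ∈ Icc 0 T, ⟪Y s, Y t⟫ = Γ s t) ∧
      ∀ t ∈ Icc 0 T, HasDerivWithinAt Y (V t) (Icc 0 T) t ∧ ‖V t‖ ^ 2 = Γ₁₁ t t ∧
        √(∫ ω, (Z' t ω - ∫ ω', Z' t ω' ∂P) ^ 2 ∂P) = ‖V t‖ ∧
        ∫ ω, (Z t ω - m t) * (Z' t ω - ∫ ω', Z' t ω' ∂P) ∂P = ⟪Y t, V t⟫ := by
  have hmem : ∀ s ∈ Icc 0 T, MemLp (fun ω => Z s ω - m s) 2 P := fun s hs =>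
    (hlaw s hs).memLp_two.sub (memLp_const _)
  obtain ⟨Y, hY⟩ := exists_L2_curve hmem
  have hYΓ : ∀ s ∈ Icc 0 T, ∀ t ∈ Icc 0 T, ⟪Y s, Y t⟫ = Γ s t := fun s hs t ht => by
    rw [inner_eq_integral_of_ae_eq (hY s hs) (hY t ht), hΓ]
  have hV : ∀ t ∈ Icc 0 T, ∃ V, HasDerivWithinAt Y V (Icc 0 T) t ∧ ‖V‖ ^ 2 = Γ₁₁ t t :=
    fun t ht => exists_hasDerivWithinAt_of_mixed_deriv hT hΓ₁ hΓ₁₁ hYΓ ht (hΓ₁₁cont t ht)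
  choose! V hV hVn using hV
  have hY0 : ∀ s ∈ Icc 0 T, ∫ ω, Y s ω ∂P = 0 := fun s hs => by
    rw [integral_congr_ae (hY s hs), MeasureTheory.integral_sub (hlaw s hs).integrable
      (integrable_const _), ← hm]
    simp
  refine ⟨Y, V, hYΓ, fun t ht => ⟨hV t ht, hVn t ht, ?_⟩⟩
  have hVae : V t =ᵐ[P] fun ω => Z' t ω - m' t := by
    refine ae_eq_of_hasDerivWithinAt_Lp hT ht hY (hV t ht) ?_
    filter_upwards [hpath] with ω h using (h t ht).sub (hm' t ht)
  have hmean : ∫ ω, Z' t ω ∂P = m' t := by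
    have hVint : Integrable (V t) P := (Lp.memLp (V t)).integrable (by norm_num)
    have h1 : Z' t =ᵐ[P] fun ω => V t ω + m' t := by
      filter_upwards [hVae] with ω h
      rw [h, sub_add_cancel]
    rw [integral_congr_ae h1, MeasureTheory.integral_add hVint (integrable_const _),
      integral_eq_zero_of_hasDerivWithinAt_Lp hT ht hY0 (hV t ht)]
    simp
  rw [hmean]
  constructor
  · have h2 := inner_eq_integral_of_ae_eq hVae hVae
    rw [real_inner_self_eq_norm_sq] at h2
    simp_rw [sq] at h2 ⊢
    rw [← h2, Real.sqrt_mul_self (norm_nonneg _)]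
  · rw [inner_eq_integral_of_ae_eq (hY t ht) hVae]

/-- The expected number of zeros of a Gaussian process whose normalized covariance is represented
by a differentiable curve `y` on the unit sphere of a Hilbert space. -/
lemma integral_ncard_zeros_eq_integral [IsProbabilityMeasure P] {H : Type*} [NormedAddCommGroup H]
    [InnerProductSpace ℝ H] {T : ℝ} (hT : 0 < T) {Z Z' : ℝ → Ω → ℝ}
    (hZ : ∀ t, Measurable (Z t))
    (hlaw : ∀ s ∈ Icc 0 T, ∀ u ∈ Icc 0 T, HasGaussianLaw (fun ω => (Z s ω, Z u ω)) P)
    (hpath : ∀ᵐ ω ∂P, (∀ s ∈ Icc 0 T, HasDerivWithinAt (fun t => Z t ω) (Z' s ω) (Icc 0 T) s) ∧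
      ContinuousOn (fun t => Z' t ω) (Icc 0 T))
    {σ M M' : ℝ → ℝ} {c K : ℝ} (hc : 0 < c) (hσ : ∀ s ∈ Icc 0 T, c ≤ σ s)
    {y v : ℝ → H} (hyn : ∀ s ∈ Icc 0 T, ‖y s‖ = 1)
    (hcov : ∀ s ∈ Icc 0 T, ∀ u ∈ Icc 0 T, cov[Z s, Z u; P] = σ s * σ u * ⟪y s, y u⟫)
    (hM : ∀ s, M s = P[Z s] / σ s)
    (hy : ∀ t ∈ Icc 0 T, HasDerivWithinAt y (v t) (Icc 0 T) t)
    (hM' : ∀ t ∈ Icc 0 T, HasDerivWithinAt M (M' t) (Icc 0 T) t)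
    (hvK : ∀ t ∈ Icc 0 T, ‖v t‖ ≤ K) (hM'K : ∀ t ∈ Icc 0 T, |M' t| ≤ K)
    (hMK : ∀ t ∈ Icc 0 T, |M t| ≤ K) :
    IntervalIntegrable
        (fun t => phi (M t) * ∫ x, |M' t + ‖v t‖ * x| ∂(gaussianReal 0 1)) volume 0 T ∧
      ∫ ω, ({t | t ∈ Icc 0 T ∧ Z t ω = 0}.ncard : ℝ) ∂P =
        ∫ t in (0 : ℝ)..T, phi (M t) * ∫ x, |M' t + ‖v t‖ * x| ∂(gaussianReal 0 1) := by
  obtain ⟨hInt, hlim⟩ := tendsto_sum_integral_crossKernel hT hyn hy hM' hvK hM'K hMK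
  refine ⟨hInt, ?_⟩
  have hvar : ∀ s ∈ Icc 0 T, Var[Z s; P] = σ s ^ 2 := fun s hs => by
    rw [← covariance_self (hZ s).aemeasurable, hcov s hs s hs, real_inner_self_eq_norm_sq, hyn s hs]
    ring
  have hball : ∀ t ∈ Icc 0 T, ∀ a, 0 ≤ a → P {ω | |Z t ω| ≤ a} ≤ ENNReal.ofReal (2 / c * a) :=
    fun t ht a ha =>
      measure_abs_le_of_hasGaussianLaw (hlaw t ht t ht).fst (hvar t ht) hc (hσ t ht) ha
  have hne : ∀ t ∈ Icc 0 T, ∀ᵐ ω ∂P, Z t ω ≠ 0 := fun t ht => by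
    have h := hball t ht 0 le_rfl
    rw [mul_zero, ENNReal.ofReal_zero, nonpos_iff_eq_zero] at h
    simpa [ae_iff] using h
  have hgrid : ∀ᵐ ω ∂P, ∀ n k : ℕ, k ≤ n + 1 → Z ((k : ℝ) * (T / (n + 1))) ω ≠ 0 := by
    simp_rw [ae_all_iff]
    exact fun n k hk => hne _ (grid_mem_Icc hT hk)
  refine integral_ncard_zeros_eq_of_tendsto hT hZ (hpath.mono fun ω h => h.1)
    (ae_forall_zero_deriv_ne_zero hT hpath (by positivity) hball) hgrid (hlim.congr' ?_)
  have hmesh : Tendsto (fun n : ℕ => K * (T / ((n : ℝ) + 1))) atTop (𝓝 0) := by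
    simpa using (tendsto_mesh T).const_mul K
  filter_upwards [hmesh.eventually_le_const one_pos] with n hn
  refine Finset.sum_congr rfl fun k hk => ?_
  have hk := Finset.mem_range.1 hk
  have hs := grid_mem_Icc hT (n := n) (k := k) (by omega)
  have hu := grid_mem_Icc hT (n := n) (k := k + 1) (by omega)
  have hyu := exists_lipschitz_bound hy hvK _ hs _ hu
  have hh : |((k + 1 : ℕ) : ℝ) * (T / (n + 1)) - k * (T / (n + 1))| = T / (n + 1) := by
    rw [← abs_of_pos (show 0 < T / ((n : ℝ) + 1) by positivity)]
    congr 1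
    rw [abs_of_pos (by positivity)]
    push_cast
    ring
  rw [hh] at hyu
  have hr := half_le_inner_of_norm_sub_le (hyn _ hs) (hyn _ hu) (hyu.trans hn)
  rw [hM, hM]
  exact (measureReal_mul_neg_of_hasGaussianLaw (hlaw _ hs _ hu) (hZ _) (hZ _)
    (hc.trans_le (hσ _ hs)) (hc.trans_le (hσ _ hu)) (hvar _ hs) (hvar _ hu) (hcov _ hs _ hu)
    (by linarith) (inner_le_one_of_norm_eq_one (hyn _ hs) (hyn _ hu))).symm

end LeadbetterCryer

/-- alternate form of the Leadbetter–Cryer integral, Theorem 4 of the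
paper.  `Z` is a Gaussian process on `[0,T]` satisfying the Leadbetter–Cryer
hypotheses; `M = m/σ` is `C¹` with finitely many zeros, all interior and simple, and
`M'` has finitely many zeros.  With `N_z^0` the number of zeros of `M`, `Emax`/`Emin`
the locations of relative maxima / nonzero relative minima of `|M|` on `[0,T]`
(endpoints counted, weight `1` at endpoints and `2` at interior points), and `Nz` the
number of zeros of `Z` in `[0,T]`:
`E[Nz] − N_z^0 = Σ_min ν_j Φ(−m_j) − Σ_max ν̂_j Φ(−M_j) + ∫_0^T (ξγ/σ)φ(m/σ)Q̃(η)`. -/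
theorem leadbetter_cryer_alternate
    {Ω : Type*} [MeasurableSpace Ω] (P : Measure Ω) [IsProbabilityMeasure P]
    (T : ℝ) (hT : 0 < T)
    (Z Z' : ℝ → Ω → ℝ)
    (hZmeas : ∀ t, Measurable (Z t))
    (hGauss : ∀ (n : ℕ) (ts : Fin n → ℝ), (∀ i, ts i ∈ Set.Icc 0 T) →
      ∀ (c : Fin n → ℝ), ∃ (μ₀ : ℝ) (v : NNReal),
        Measure.map (fun ω => ∑ i, c i * Z (ts i) ω) P = gaussianReal μ₀ v)
    (hpath : ∀ᵐ ω ∂P, ContinuousOn (fun t => Z t ω) (Set.Icc 0 T) ∧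
      (∀ s ∈ Set.Icc 0 T, HasDerivWithinAt (fun t => Z t ω) (Z' s ω) (Set.Icc 0 T) s) ∧
      ContinuousOn (fun t => Z' t ω) (Set.Icc 0 T))
    (m m' σ ξ μc γ η : ℝ → ℝ) (Γ Γ₁ Γ₁₁ : ℝ → ℝ → ℝ)
    (hm : ∀ s, m s = ∫ ω, Z s ω ∂P)
    (hm' : ∀ s ∈ Set.Icc 0 T, HasDerivWithinAt m (m' s) (Set.Icc 0 T) s)
    (hm'cont : ContinuousOn m' (Set.Icc 0 T))
    (hΓ : ∀ s t, Γ s t = ∫ ω, (Z s ω - m s) * (Z t ω - m t) ∂P)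
    (hΓ₁ : ∀ t ∈ Set.Icc 0 T, ∀ s ∈ Set.Icc (0 : ℝ) T,
      HasDerivWithinAt (fun u => Γ u t) (Γ₁ s t) (Set.Icc 0 T) s)
    (hΓ₁₁ : ∀ s ∈ Set.Icc 0 T, ∀ t ∈ Set.Icc (0 : ℝ) T,
      HasDerivWithinAt (fun u => Γ₁ s u) (Γ₁₁ s t) (Set.Icc 0 T) t)
    (hΓ₁₁cont : ∀ s ∈ Set.Icc (0 : ℝ) T,
      ContinuousWithinAt (fun p : ℝ × ℝ => Γ₁₁ p.1 p.2)
        (Set.Icc 0 T ×ˢ Set.Icc 0 T) (s, s))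
    (hσ : ∀ s, σ s = Real.sqrt (Γ s s))
    (hσpos : ∀ s ∈ Set.Icc 0 T, 0 < σ s)
    (hξ : ∀ s, ξ s = Real.sqrt (∫ ω, (Z' s ω - ∫ ω', Z' s ω' ∂P) ^ 2 ∂P))
    (hμc : ∀ s, μc s =
      (∫ ω, (Z s ω - m s) * (Z' s ω - ∫ ω', Z' s ω' ∂P) ∂P) / (σ s * ξ s))
    (hμne : ∀ s ∈ Set.Icc 0 T, μc s ≠ 1 ∧ μc s ≠ -1)
    (hγ : ∀ s, γ s = Real.sqrt (1 - μc s ^ 2))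
    (hη : ∀ s, η s = (m' s - ξ s * μc s * m s / σ s) / (ξ s * γ s))
    -- the normalized mean `M = m/σ` and its zero/extremum structure
    (M M' : ℝ → ℝ)
    (hM : ∀ t, M t = m t / σ t)
    (hMderiv : ∀ t ∈ Set.Icc (0 : ℝ) T, HasDerivWithinAt M (M' t) (Set.Icc 0 T) t)
    (hM'cont : ContinuousOn M' (Set.Icc 0 T))
    (hzfin : {t | t ∈ Set.Icc (0 : ℝ) T ∧ M t = 0}.Finite)
    (hzint : ∀ t ∈ Set.Icc (0 : ℝ) T, M t = 0 → t ∈ Set.Ioo (0 : ℝ) T)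
    (hzsimple : ∀ t ∈ Set.Icc (0 : ℝ) T, M t = 0 → M' t ≠ 0)
    (hcritfin : {t | t ∈ Set.Icc (0 : ℝ) T ∧ M' t = 0}.Finite)
    (Emax Emin : Finset ℝ)
    (hEmax : ∀ x, x ∈ Emax ↔
      (x ∈ Set.Icc (0 : ℝ) T ∧ IsLocalMaxOn (fun t => |M t|) (Set.Icc 0 T) x))
    (hEmin : ∀ x, x ∈ Emin ↔
      (x ∈ Set.Icc (0 : ℝ) T ∧ M x ≠ 0 ∧
        IsLocalMinOn (fun t => |M t|) (Set.Icc 0 T) x))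
    (Nz : Ω → ℕ)
    (hNz : ∀ ω, Nz ω = Set.ncard {t | t ∈ Set.Icc 0 T ∧ Z t ω = 0}) :
    (∫ ω, (Nz ω : ℝ) ∂P) - ({t | t ∈ Set.Icc (0 : ℝ) T ∧ M t = 0}.ncard : ℝ)
      = (∑ x ∈ Emin, (if x = 0 ∨ x = T then (1:ℝ) else 2) * Phi (-|M x|))
        - (∑ x ∈ Emax, (if x = 0 ∨ x = T then (1:ℝ) else 2) * Phi (-|M x|))
        + ∫ s in (0:ℝ)..T, (ξ s * γ s / σ s) * phi (m s / σ s) * Qt (η s) := by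
  classical
  have hpair : ∀ s ∈ Icc 0 T, ∀ u ∈ Icc 0 T, HasGaussianLaw (fun ω => (Z s ω, Z u ω)) P :=
    fun s hs u hu => hasGaussianLaw_pair hZmeas hGauss hs hu
  obtain ⟨Y, V, hYΓ, hV⟩ := exists_Lp_curve_of_hasGaussianLaw hT
    (fun s hs => (hpair s hs s hs).fst) (hpath.mono fun ω h => h.2.1) hm hm' hΓ hΓ₁ hΓ₁₁ hΓ₁₁cont
  have hσY : ∀ s ∈ Icc 0 T, σ s = ‖Y s‖ := fun s hs => by
    rw [hσ, ← hYΓ s hs s hs, real_inner_self_eq_norm_sq, Real.sqrt_sq (norm_nonneg _)]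
  have hv : ∀ t ∈ Icc 0 T, ∃ v, HasDerivWithinAt (fun s => ‖Y s‖⁻¹ • Y s) v (Icc 0 T) t ∧
      ‖v‖ = ξ t * γ t / σ t ∧ ‖v‖ ^ 2 ≤ ‖V t‖ ^ 2 / σ t ^ 2 ∧ η t = M' t / ‖v‖ := fun t ht => by
    obtain ⟨hVt, -, hξt, hμt⟩ := hV t ht
    rw [hη, hγ]
    exact exists_normalized_deriv hT ht hVt hσY (hσpos t ht) (hm' t ht) hM (hMderiv t ht)
      ((hξ t).trans hξt) ((hμc t).trans (by rw [hμt]))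
  choose! v hvderiv hvnorm hvle hvη using hv
  have hMcont : ContinuousOn M (Icc 0 T) := fun t ht => (hMderiv t ht).continuousWithinAt
  have hσcont : ContinuousOn σ (Icc 0 T) :=
    ContinuousOn.congr (fun t ht => (hV t ht).1.continuousWithinAt.norm) hσY
  have hΓcont : ContinuousOn (fun t => Γ₁₁ t t) (Icc 0 T) := fun t ht =>
    (hΓ₁₁cont t ht).comp (f := fun t : ℝ => (t, t)) (by fun_prop) fun s hs => ⟨hs, hs⟩
  obtain ⟨t₀, ht₀, hmin⟩ := isCompact_Icc.exists_isMinOn (nonempty_Icc.2 hT.le) hσcont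
  obtain ⟨K₁, hK₁⟩ := isCompact_Icc.exists_bound_of_continuousOn hMcont
  obtain ⟨K₂, hK₂⟩ := isCompact_Icc.exists_bound_of_continuousOn hM'cont
  obtain ⟨K₃, hK₃⟩ := isCompact_Icc.exists_bound_of_continuousOn hΓcont
  have hc := hσpos t₀ ht₀
  have hvK : ∀ t ∈ Icc 0 T, ‖v t‖ ≤ √(K₃ / σ t₀ ^ 2) := fun t ht => by
    refine Real.le_sqrt_of_sq_le ((hvle t ht).trans ?_)
    rw [(hV t ht).2.1]
    have h1 := (le_abs_self _).trans (hK₃ t ht)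
    have h2 : 0 ≤ Γ₁₁ t t := (hV t ht).2.1 ▸ sq_nonneg _
    have h3 : σ t₀ ≤ σ t := hmin ht
    have h4 : 0 ≤ K₃ := h2.trans h1
    gcongr
  obtain ⟨hInt, hcount⟩ := integral_ncard_zeros_eq_integral hT hZmeas hpair
    (hpath.mono fun ω h => h.2) hc (fun s hs => hmin hs) (y := fun s => ‖Y s‖⁻¹ • Y s) (v := v)
    (M := M) (M' := M') (K := max √(K₃ / σ t₀ ^ 2) (max K₁ K₂))
    (fun s hs => norm_smul_inv_norm (norm_pos_iff.1 (hσY s hs ▸ hσpos s hs)))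
    (fun s hs u hu => by
      rw [real_inner_smul_left, real_inner_smul_right, hYΓ s hs u hu, ← hσY s hs, ← hσY u hu,
        covariance, hΓ, hm, hm]
      have := (hσpos s hs).ne'
      have := (hσpos u hu).ne'
      field_simp)
    (fun s => by rw [hM, hm]) hvderiv hMderiv (fun t ht => (hvK t ht).trans (le_max_left _ _))
    (fun t ht => (hK₂ t ht).trans ((le_max_right _ _).trans (le_max_right _ _)))
    (fun t ht => (hK₁ t ht).trans ((le_max_left _ _).trans (le_max_right _ _)))
  have hsplit : ∀ t ∈ Icc 0 T, (ξ t * γ t / σ t) * phi (m t / σ t) * Qt (η t) =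
      phi (M t) * (∫ x, |M' t + ‖v t‖ * x| ∂(gaussianReal 0 1)) - phi (M t) * |M' t| := by
    intro t ht
    rw [integral_abs_add_mul_gaussianReal _ (norm_nonneg _), ← hvη t ht, ← hvnorm t ht, ← hM]
    ring
  have hTV : IntervalIntegrable (fun t => phi (M t) * |M' t|) volume 0 T := by
    refine ContinuousOn.intervalIntegrable ?_
    rw [uIcc_of_le hT.le]
    exact (continuous_phi.comp_continuousOn hMcont).mul hM'cont.abs
  rw [integral_congr (g := fun t => phi (M t) * (∫ x, |M' t + ‖v t‖ * x| ∂(gaussianReal 0 1)) -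
    phi (M t) * |M' t|) (by rw [uIcc_of_le hT.le]; exact hsplit),
    intervalIntegral.integral_sub hInt hTV, ← hcount,
    integral_phi_mul_abs_deriv hT hMderiv hM'cont hzfin hzint hcritfin Emax Emin hEmax hEmin]
  simp_rw [hNz]
  ring
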